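/- Let p and q be odd integers with 5 ≤ p ≤ q and (p,q) ≠ (5,5). Then the presented group Γ_{2(p+q)-1}(p,q) is infinite. -/

import Mathlib

/-- The relators of the presented group `Γ_s(p,q)`, the fundamental group of `s`-surgery
on the `(-2,p,q)` pretzel knot (via the Wirtinger presentation), on generators
`x = of 0`, `y = of 1`, `z = of 2`. -/
def pretzelRels (p q s : ℤ) : Set (FreeGroup (Fin 3)) :=
  let x : FreeGroup (Fin 3) := FreeGroup.of 0
  let y : FreeGroup (Fin 3) := FreeGroup.of 1
  let z : FreeGroup (Fin 3) := FreeGroup.of 2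
  let l : FreeGroup (Fin 3) :=
    x ^ (-2 * (p + q)) * (y * x) ^ ((q - 1) / 2) * (y * z⁻¹)⁻¹ * (y * x) ^ ((q + 1) / 2) *
      (z * x) ^ ((p - 1) / 2) * (y * z⁻¹) * (z * x) ^ ((p + 1) / 2)
  { (z * x) ^ ((p - 1) / 2) * z * (z * x) ^ (-((p - 1) / 2)) *
      ((y * x) ^ (-((q + 1) / 2)) * y * (y * x) ^ ((q + 1) / 2))⁻¹,
    (y * z⁻¹)⁻¹ * y * (y * z⁻¹) *
      ((y * x) ^ (-((q - 1) / 2)) * x * (y * x) ^ ((q - 1) / 2))⁻¹,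
    (y * z⁻¹)⁻¹ * z * (y * z⁻¹) *
      ((z * x) ^ ((p + 1) / 2) * x * (z * x) ^ (-((p + 1) / 2)))⁻¹,
    x ^ s * l }


set_option linter.unusedSimpArgs false


set_option maxHeartbeats 4000000 in
theorem pretzel_hom {G : Type*} [Group G] (m n : ℤ) (u k a b g h : G)
    (ha : a = u * u * k * k * u * k * k * u)
    (hb : b = u⁻¹ * k⁻¹ * k⁻¹ * u⁻¹ * k * u * u * k * k * k * u * u * u * k * k * u)
    (hg : g = u⁻¹ * k⁻¹ * k⁻¹ * k⁻¹ * u⁻¹ * u⁻¹ * k⁻¹ * u * k * k * u)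
    (hh : h = u⁻¹ * k⁻¹ * k⁻¹ * u⁻¹ * k)
    (hR : u * u * u * k * k * k * u * u * k * u⁻¹ * k⁻¹ * k⁻¹ * u⁻¹ * u⁻¹ * u⁻¹ * k⁻¹ * k⁻¹ *
      k⁻¹ * u⁻¹ * u⁻¹ * k⁻¹ * u * k * k = 1)
    (hag : a ^ m = g) (hbh : b ^ n = h) :
    ∃ f : PresentedGroup (pretzelRels (2 * n + 1) (2 * m + 1)
      (2 * ((2 * n + 1) + (2 * m + 1)) - 1)) →* G, ∃ w, f w = b := by
  obtain ⟨x, hx⟩ : ∃ x, x = u * u * k * k := ⟨_, rfl⟩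
  have e1 : (2 * n + 1 - 1) / 2 = n := by omega
  have e2 : (2 * m + 1 - 1) / 2 = m := by omega
  have e3 : (2 * n + 1 + 1) / 2 = 1 + n := by omega
  have e4 : (2 * m + 1 + 1) / 2 = 1 + m := by omega
  have r1 : h * b * x⁻¹ * h⁻¹ * ((a * g)⁻¹ * (a * x⁻¹) * (a * g))⁻¹ = 1 := by
    have : h * b * x⁻¹ * h⁻¹ * ((a * g)⁻¹ * (a * x⁻¹) * (a * g))⁻¹ =
      (u⁻¹ * k⁻¹ * k⁻¹ * u⁻¹ * k * u * u * k * k * k * u * u * k * u⁻¹ * k⁻¹ * k⁻¹ * u⁻¹ * u⁻¹ * u⁻¹ * k⁻¹ * k⁻¹ * k⁻¹ * u⁻¹ * u⁻¹ * k⁻¹ * u * k * k) * (u * u * u * k * k * k * u * u * k * u⁻¹ * k⁻¹ * k⁻¹ * u⁻¹ * u⁻¹ * u⁻¹ * k⁻¹ * k⁻¹ *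
      k⁻¹ * u⁻¹ * u⁻¹ * k⁻¹ * u * k * k)⁻¹ * (u⁻¹ * k⁻¹ * k⁻¹ * u⁻¹ * k * u * u * k * k * k * u * u * k * u⁻¹ * k⁻¹ * k⁻¹ * u⁻¹ * u⁻¹ * u⁻¹ * k⁻¹ * k⁻¹ * k⁻¹ * u⁻¹ * u⁻¹ * k⁻¹ * u * k * k)⁻¹ := by
      rw [ha, hb, hg, hh, hx]; simp only [mul_assoc, mul_inv_rev, inv_inv, mul_inv_cancel_left, inv_mul_cancel_left, mul_inv_cancel, inv_mul_cancel, mul_one, one_mul]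
    rw [this, hR]; simp
  have r2 : b * x⁻¹ * a * b⁻¹ * (g⁻¹ * x * g)⁻¹ = 1 := by
    rw [ha, hb, hg, hx]; simp only [mul_assoc, mul_inv_rev, inv_inv, mul_inv_cancel_left, inv_mul_cancel_left, mul_inv_cancel, inv_mul_cancel, mul_one, one_mul]
  have r3 : b * a⁻¹ * b * x⁻¹ * a * b⁻¹ * (b * h * x * (b * h)⁻¹)⁻¹ = 1 := by
    have : b * a⁻¹ * b * x⁻¹ * a * b⁻¹ * (b * h * x * (b * h)⁻¹)⁻¹ =
      (u⁻¹ * k⁻¹ * k⁻¹ * u⁻¹ * k * u * u * k * k * k * u * u * k * u * u * k * u⁻¹ * k⁻¹ * k⁻¹ * u⁻¹ * u⁻¹ * u⁻¹ * k⁻¹ * k⁻¹ * k⁻¹ * u⁻¹ * u⁻¹ * k⁻¹ * u * k * k) * (u * u * u * k * k * k * u * u * k * u⁻¹ * k⁻¹ * k⁻¹ * u⁻¹ * u⁻¹ * u⁻¹ * k⁻¹ * k⁻¹ *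
      k⁻¹ * u⁻¹ * u⁻¹ * k⁻¹ * u * k * k)⁻¹ * (u⁻¹ * k⁻¹ * k⁻¹ * u⁻¹ * k * u * u * k * k * k * u * u * k * u * u * k * u⁻¹ * k⁻¹ * k⁻¹ * u⁻¹ * u⁻¹ * u⁻¹ * k⁻¹ * k⁻¹ * k⁻¹ * u⁻¹ * u⁻¹ * k⁻¹ * u * k * k)⁻¹ := by
      rw [ha, hb, hh, hx]; simp only [mul_assoc, mul_inv_rev, inv_inv, mul_inv_cancel_left, inv_mul_cancel_left, mul_inv_cancel, inv_mul_cancel, mul_one, one_mul]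
    rw [this, hR]; simp
  have r4 : x⁻¹ * (g * (b * a⁻¹) * (a * g) * h * (a * b⁻¹) * (b * h)) = 1 := by
    rw [ha, hb, hg, hh, hx]; simp only [mul_assoc, mul_inv_rev, inv_inv, mul_inv_cancel_left, inv_mul_cancel_left, mul_inv_cancel, inv_mul_cancel, mul_one, one_mul]
  have key : ∀ r ∈ pretzelRels (2 * n + 1) (2 * m + 1)
      (2 * ((2 * n + 1) + (2 * m + 1)) - 1),
      FreeGroup.lift (![x, a * x⁻¹, b * x⁻¹] : Fin 3 → G) r = 1 := by
    intro r hr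
    simp only [pretzelRels, e1, e2, e3, e4, Set.mem_insert_iff, Set.mem_singleton_iff] at hr
    rcases hr with rfl | rfl | rfl | rfl
    · simp only [map_mul, map_inv, map_zpow, FreeGroup.lift_apply_of, Matrix.cons_val_zero,
        Matrix.cons_val_one, Matrix.cons_val, inv_mul_cancel_right, zpow_neg, zpow_one_add, hag, hbh]
      rw [← r1]; group
    · simp only [map_mul, map_inv, map_zpow, FreeGroup.lift_apply_of, Matrix.cons_val_zero,
        Matrix.cons_val_one, Matrix.cons_val, inv_mul_cancel_right, zpow_neg, zpow_one_add, hag, hbh]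
      rw [← r2]; group
    · simp only [map_mul, map_inv, map_zpow, FreeGroup.lift_apply_of, Matrix.cons_val_zero,
        Matrix.cons_val_one, Matrix.cons_val, inv_mul_cancel_right, zpow_neg, zpow_one_add, hag, hbh]
      rw [← r3]; group
    · simp only [map_mul, map_inv, map_zpow, FreeGroup.lift_apply_of, Matrix.cons_val_zero,
        Matrix.cons_val_one, Matrix.cons_val, inv_mul_cancel_right, zpow_one_add, hag, hbh]
      rw [← r4]
      have : x ^ (2 * (2 * n + 1 + (2 * m + 1)) - 1) * x ^ (-2 * (2 * n + 1 + (2 * m + 1))) = x⁻¹ := by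
        rw [← zpow_add, ← zpow_neg_one]; congr 1; ring
      rw [← this]
      group
  refine ⟨PresentedGroup.toGroup key, PresentedGroup.of 2 * PresentedGroup.of 0, ?_⟩
  rw [map_mul, PresentedGroup.toGroup.of, PresentedGroup.toGroup.of]
  simp

theorem fin_two_sq (A : Matrix (Fin 2) (Fin 2) ℝ) (hd : A.det = 1) :
    A * A = A.trace • A - 1 := by
  rw [Matrix.det_fin_two] at hd
  ext i j
  fin_cases i <;> fin_cases j <;>
    simp [Matrix.mul_apply, Fin.sum_univ_two, Matrix.trace_fin_two] <;> linarith

theorem trace_pow_succ_succ (A : Matrix (Fin 2) (Fin 2) ℝ) (hd : A.det = 1) (j : ℕ) :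
    (A ^ (j + 2)).trace = A.trace * (A ^ (j + 1)).trace - (A ^ j).trace := by
  have : A ^ (j + 2) = A.trace • A ^ (j + 1) - A ^ j := by
    rw [pow_add, pow_two, fin_two_sq A hd, mul_sub, mul_smul_comm, ← pow_succ, mul_one]
  rw [this, Matrix.trace_sub, Matrix.trace_smul, smul_eq_mul]

theorem trace_pow_cos (A : Matrix (Fin 2) (Fin 2) ℝ) (hd : A.det = 1) (φ : ℝ)
    (ht : A.trace = 2 * Real.cos φ) (j : ℕ) : (A ^ j).trace = 2 * Real.cos (j * φ) := by
  have key : ∀ j : ℕ, (A ^ j).trace = 2 * Real.cos (j * φ) ∧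
      (A ^ (j + 1)).trace = 2 * Real.cos ((j + 1 : ℕ) * φ) := by
    intro j
    induction j with
    | zero => simp [ht]
    | succ j ih =>
      refine ⟨ih.2, ?_⟩
      rw [trace_pow_succ_succ A hd, ih.1, ih.2, ht]
      have e1 : ((j + 1 + 1 : ℕ) : ℝ) * φ = (j + 1 : ℕ) * φ + φ := by push_cast; ring
      have e2 : ((j : ℕ) : ℝ) * φ = (j + 1 : ℕ) * φ - φ := by push_cast; ring
      rw [e1, e2, Real.cos_add, Real.cos_sub]; ring
  exact (key j).1

theorem trace_pow_cosh (A : Matrix (Fin 2) (Fin 2) ℝ) (hd : A.det = 1) (φ : ℝ)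
    (ht : A.trace = 2 * Real.cosh φ) (j : ℕ) : (A ^ j).trace = 2 * Real.cosh (j * φ) := by
  have key : ∀ j : ℕ, (A ^ j).trace = 2 * Real.cosh (j * φ) ∧
      (A ^ (j + 1)).trace = 2 * Real.cosh ((j + 1 : ℕ) * φ) := by
    intro j
    induction j with
    | zero => simp [ht]
    | succ j ih =>
      refine ⟨ih.2, ?_⟩
      rw [trace_pow_succ_succ A hd, ih.1, ih.2, ht]
      have e1 : ((j + 1 + 1 : ℕ) : ℝ) * φ = (j + 1 : ℕ) * φ + φ := by push_cast; ring
      have e2 : ((j : ℕ) : ℝ) * φ = (j + 1 : ℕ) * φ - φ := by push_cast; ring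
      rw [e1, e2, Real.cosh_add, Real.cosh_sub]; ring
  exact (key j).1

theorem commute_trace_zero (A D : Matrix (Fin 2) (Fin 2) ℝ) (hd : A.det = 1)
    (h4 : A.trace ^ 2 ≠ 4) (hc : A * D = D * A) (h0 : D.trace = 0) (h1 : (A * D).trace = 0) :
    D = 0 := by
  obtain ⟨a, b, c, d, rfl⟩ : ∃ a b c d, A = !![a, b; c, d] := ⟨_, _, _, _, Matrix.eta_fin_two A⟩
  obtain ⟨p, q, r, s, rfl⟩ : ∃ a b c d, D = !![a, b; c, d] := ⟨_, _, _, _, Matrix.eta_fin_two D⟩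
  simp only [Matrix.mul_fin_two, Matrix.trace_fin_two_of, Matrix.det_fin_two_of] at *
  have e00 := congrFun (congrFun hc 0) 0
  have e01 := congrFun (congrFun hc 0) 1
  have e10 := congrFun (congrFun hc 1) 0
  simp at e00 e01 e10
  have hs : s = -p := by linarith
  subst hs
  have hΔ : (a - d) ^ 2 + 4 * b * c ≠ 0 := by
    intro h; apply h4; linear_combination h + 4 * hd
  have hp : p * ((a - d) ^ 2 + 4 * b * c) = 0 := by
    linear_combination (a - d) * h1 + 2 * b * e10 + (a - d) * e00
  have hq : q * ((a - d) ^ 2 + 4 * b * c) = 0 := by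
    linear_combination (a - d) * e01 + 2 * b * h1 - 2 * b * e00
  have hr : r * ((a - d) ^ 2 + 4 * b * c) = 0 := by
    linear_combination -(a - d) * e10 + 2 * c * h1 + 2 * c * e00
  simp [hΔ] at hp hq hr
  simp [hp, hq, hr]
  ext i j; fin_cases i <;> fin_cases j <;> rfl

theorem eq_pow_of_trace (A g : Matrix.SpecialLinearGroup (Fin 2) ℝ) (m : ℕ)
    (h4 : A.1.trace ^ 2 ≠ 4) (hc : A * g = g * A) (h0 : g.1.trace = (A.1 ^ m).trace)
    (h1 : (A * g).1.trace = (A.1 ^ (m + 1)).trace) : A ^ m = g := by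
  have := commute_trace_zero A.1 (g.1 - A.1 ^ m) A.2 h4 (by
    rw [mul_sub, sub_mul, ← pow_succ, ← pow_succ']
    congr 1
    exact congrArg Subtype.val hc) (by rw [Matrix.trace_sub, h0, sub_self]) (by
    rw [mul_sub, Matrix.trace_sub, ← pow_succ', ← h1]
    simp)
  apply Subtype.ext
  rw [Matrix.SpecialLinearGroup.coe_pow]
  exact (sub_eq_zero.1 this).symm

open Matrix.SpecialLinearGroup in
theorem pretzel_infinite_of_rep (m n : ℕ) (u k a b g h : Matrix.SpecialLinearGroup (Fin 2) ℝ)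
    (ha : a = u * u * k * k * u * k * k * u)
    (hb : b = u⁻¹ * k⁻¹ * k⁻¹ * u⁻¹ * k * u * u * k * k * k * u * u * u * k * k * u)
    (hg : g = u⁻¹ * k⁻¹ * k⁻¹ * k⁻¹ * u⁻¹ * u⁻¹ * k⁻¹ * u * k * k * u)
    (hh : h = u⁻¹ * k⁻¹ * k⁻¹ * u⁻¹ * k)
    (hR : u * u * u * k * k * k * u * u * k * u⁻¹ * k⁻¹ * k⁻¹ * u⁻¹ * u⁻¹ * u⁻¹ * k⁻¹ * k⁻¹ *
      k⁻¹ * u⁻¹ * u⁻¹ * k⁻¹ * u * k * k = 1)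
    (hag : a ^ m = g ∨ a ^ m = -g) (hbh : b ^ n = h) (htr : 2 < b.1.trace) :
    Infinite (PresentedGroup (pretzelRels (2 * n + 1) (2 * m + 1)
      (2 * ((2 * n + 1) + (2 * m + 1)) - 1))) := by
  let π := QuotientGroup.mk' (Subgroup.center (Matrix.SpecialLinearGroup (Fin 2) ℝ))
  have hπ : ∀ g, π (-g) = π g := by
    intro g
    rw [QuotientGroup.mk'_eq_mk']
    refine ⟨-1, ?_, by simp⟩
    rw [Subgroup.mem_center_iff]; intro g; simp
  obtain ⟨f, w, hw⟩ := pretzel_hom (m : ℤ) n (π u) (π k) (π a) (π b) (π g) (π h)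
    (by rw [ha]; simp only [map_mul]) (by rw [hb]; simp only [map_mul, map_inv])
    (by rw [hg]; simp only [map_mul, map_inv]) (by rw [hh]; simp only [map_mul, map_inv])
    (by simpa only [map_mul, map_inv, map_one] using congrArg π hR)
    (by rw [zpow_natCast, ← map_pow]; rcases hag with h | h <;> rw [h]; exact hπ _)
    (by rw [zpow_natCast, ← map_pow, hbh])
  by_contra hfin
  rw [not_infinite_iff_finite] at hfin
  obtain ⟨j, hj, hwj⟩ := (isOfFinOrder_of_finite w).exists_pow_eq_one
  have h1 : π (b ^ j) = 1 := by rw [map_pow, ← hw, ← map_pow, hwj, map_one]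
  have h2 : b ^ j ∈ Subgroup.center (Matrix.SpecialLinearGroup (Fin 2) ℝ) := by
    rwa [← QuotientGroup.eq_one_iff]
  rw [Matrix.SpecialLinearGroup.mem_center_iff] at h2
  obtain ⟨r, hr, hrb⟩ := h2
  set φ := Real.arcosh (b.1.trace / 2) with hφ
  have hφ1 : b.1.trace = 2 * Real.cosh φ := by
    rw [hφ, Real.cosh_arcosh (by linarith)]; ring
  have hφ0 : φ ≠ 0 := by
    intro h0; rw [h0, Real.cosh_zero] at hφ1; linarith
  have h3 := trace_pow_cosh b.1 b.2 φ hφ1 j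
  have h4 : 1 < Real.cosh (j * φ) := by
    rw [Real.one_lt_cosh]
    exact mul_ne_zero (by exact_mod_cast hj.ne') hφ0
  rw [← Matrix.SpecialLinearGroup.coe_pow, ← hrb] at h3
  simp [Matrix.trace_fin_two] at h3
  simp at hr
  rcases hr with rfl | rfl <;> linarith

/-- The first matrix of the two-generator representation. -/
def mu (ξ : ℝ) : Matrix.SpecialLinearGroup (Fin 2) ℝ :=
  ⟨!![ξ, -1; 1, 0], by simp [Matrix.det_fin_two_of]⟩

/-- The second matrix of the two-generator representation. -/
noncomputable def mk (κ ζ : ℝ) (hζ : ζ ≠ 0) : Matrix.SpecialLinearGroup (Fin 2) ℝ :=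
  ⟨!![0, ζ; -ζ⁻¹, κ], by simp [Matrix.det_fin_two_of, hζ]⟩

theorem mu_coe (ξ : ℝ) : (mu ξ).1 = !![ξ, -1; 1, 0] := rfl

theorem mk_coe (κ ζ : ℝ) (hζ : ζ ≠ 0) : (mk κ ζ hζ).1 = !![0, ζ; -ζ⁻¹, κ] := rfl

theorem mu_inv_coe (ξ : ℝ) : ((mu ξ)⁻¹).1 = !![0, 1; -1, ξ] := by
  rw [Matrix.SpecialLinearGroup.coe_inv, mu_coe, Matrix.adjugate_fin_two_of]; simp

theorem mk_inv_coe (κ ζ : ℝ) (hζ : ζ ≠ 0) : ((mk κ ζ hζ)⁻¹).1 = !![κ, -ζ; ζ⁻¹, 0] := by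
  rw [Matrix.SpecialLinearGroup.coe_inv, mk_coe, Matrix.adjugate_fin_two_of]; simp

theorem exists_zeta (z : ℝ) (hz : 4 ≤ z ^ 2) : ∃ ζ : ℝ, ζ ≠ 0 ∧ z = ζ + ζ⁻¹ := by
  have hs := Real.sq_sqrt (show 0 ≤ z ^ 2 - 4 by linarith)
  set r := √(z ^ 2 - 4)
  have h1 : ((z + r) / 2) * ((z - r) / 2) = 1 := by linear_combination -hs / 4
  refine ⟨(z + r) / 2, left_ne_zero_of_mul_eq_one h1, ?_⟩
  rw [inv_eq_of_mul_eq_one_right h1]; ring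

theorem half1 (ξ κ ζ : ℝ) (hζ : ζ ≠ 0) :
    (mu ξ * mu ξ * mk κ ζ hζ * mk κ ζ hζ : Matrix.SpecialLinearGroup (Fin 2) ℝ).1 =
      !![1 + ξ * κ * ζ⁻¹ - ξ ^ 2, -κ * ζ + ξ - ξ * κ ^ 2 + ξ ^ 2 * κ * ζ;
        κ * ζ⁻¹ - ξ, 1 - κ ^ 2 + ξ * κ * ζ] := by
  simp only [Matrix.SpecialLinearGroup.coe_mul, mu_coe, mu_inv_coe, mk_coe, mk_inv_coe,
    Matrix.mul_fin_two]
  ext i j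
  fin_cases i <;> fin_cases j <;> simp <;> field_simp <;> ring

theorem half2 (ξ κ ζ : ℝ) (hζ : ζ ≠ 0) :
    (mu ξ * mk κ ζ hζ * mk κ ζ hζ * mu ξ : Matrix.SpecialLinearGroup (Fin 2) ℝ).1 =
      !![1 - κ ^ 2 + ξ * κ * ζ⁻¹ + ξ * κ * ζ - ξ ^ 2, -κ * ζ⁻¹ + ξ;
        κ * ζ - ξ, 1] := by
  simp only [Matrix.SpecialLinearGroup.coe_mul, mu_coe, mu_inv_coe, mk_coe, mk_inv_coe,
    Matrix.mul_fin_two]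
  ext i j
  fin_cases i <;> fin_cases j <;> simp <;> field_simp <;> ring

theorem tr_a (ξ κ ζ z : ℝ) (hζ : ζ ≠ 0) (hz : z = ζ + ζ⁻¹) :
    (mu ξ * mu ξ * mk κ ζ hζ * mk κ ζ hζ * mu ξ * mk κ ζ hζ * mk κ ζ hζ * mu ξ : Matrix.SpecialLinearGroup (Fin 2) ℝ).1.trace =
      2 - 1 * κ ^ 2 * z ^ 2 + 4 * ξ * κ * z - 1 * ξ * κ ^ 3 * z - 4 * ξ ^ 2 + 1 * ξ ^ 2 * κ ^ 2 + 1 * ξ ^ 2 * κ ^ 2 * z ^ 2 - 2 * ξ ^ 3 * κ * z + 1 * ξ ^ 4 := by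
  have e : (mu ξ * mu ξ * mk κ ζ hζ * mk κ ζ hζ * mu ξ * mk κ ζ hζ * mk κ ζ hζ * mu ξ : Matrix.SpecialLinearGroup (Fin 2) ℝ) =
    (mu ξ * mu ξ * mk κ ζ hζ * mk κ ζ hζ) * (mu ξ * mk κ ζ hζ * mk κ ζ hζ * mu ξ) := by
    simp only [mul_assoc]
  rw [e, Matrix.SpecialLinearGroup.coe_mul, half1, half2, Matrix.mul_fin_two,
    Matrix.trace_fin_two_of, hz]
  field_simp
  ring

theorem half3 (ξ κ ζ : ℝ) (hζ : ζ ≠ 0) :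
    ((mu ξ)⁻¹ * (mk κ ζ hζ)⁻¹ * (mk κ ζ hζ)⁻¹ * (mu ξ)⁻¹ * mk κ ζ hζ * mu ξ * mu ξ * mk κ ζ hζ : Matrix.SpecialLinearGroup (Fin 2) ℝ).1 =
      !![1 + κ ^ 2 * ζ⁻¹ ^ 2 - ξ * κ * ζ⁻¹ ^ 3 - ξ * κ * ζ⁻¹ + ξ ^ 2 * ζ⁻¹ ^ 2, κ * ζ⁻¹ - κ * ζ - κ ^ 3 * ζ⁻¹ - ξ + ξ * ζ ^ 2 + ξ * κ ^ 2 * ζ⁻¹ ^ 2 + 2 * ξ * κ ^ 2 - 2 * ξ ^ 2 * κ * ζ⁻¹ - ξ ^ 2 * κ * ζ + ξ ^ 3;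
        κ * ζ⁻¹ - κ * ζ - κ ^ 3 * ζ⁻¹ - ξ * ζ⁻¹ ^ 2 + ξ + 2 * ξ * κ ^ 2 * ζ⁻¹ ^ 2 + ξ * κ ^ 2 - ξ ^ 2 * κ * ζ⁻¹ ^ 3 - 2 * ξ ^ 2 * κ * ζ⁻¹ + ξ ^ 3 * ζ⁻¹ ^ 2, 1 - 2 * κ ^ 2 + κ ^ 2 * ζ ^ 2 + κ ^ 4 + 2 * ξ * κ * ζ⁻¹ + ξ * κ * ζ - ξ * κ * ζ ^ 3 - 2 * ξ * κ ^ 3 * ζ⁻¹ - 2 * ξ * κ ^ 3 * ζ - 2 * ξ ^ 2 + ξ ^ 2 * ζ ^ 2 + ξ ^ 2 * κ ^ 2 * ζ⁻¹ ^ 2 + 4 * ξ ^ 2 * κ ^ 2 + ξ ^ 2 * κ ^ 2 * ζ ^ 2 - 2 * ξ ^ 3 * κ * ζ⁻¹ - 2 * ξ ^ 3 * κ * ζ + ξ ^ 4] := by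
  simp only [Matrix.SpecialLinearGroup.coe_mul, mu_coe, mu_inv_coe, mk_coe, mk_inv_coe,
    Matrix.mul_fin_two]
  ext i j
  fin_cases i <;> fin_cases j <;> simp <;> field_simp <;> ring

theorem half4 (ξ κ ζ : ℝ) (hζ : ζ ≠ 0) :
    (mk κ ζ hζ * mk κ ζ hζ * mu ξ * mu ξ * mu ξ * mk κ ζ hζ * mk κ ζ hζ * mu ξ : Matrix.SpecialLinearGroup (Fin 2) ℝ).1 =
      !![1 - κ ^ 2 - κ ^ 2 * ζ ^ 2 + ξ * κ * ζ⁻¹ + 4 * ξ * κ * ζ - ξ * κ ^ 3 * ζ - 3 * ξ ^ 2 + 2 * ξ ^ 2 * κ ^ 2 + ξ ^ 2 * κ ^ 2 * ζ ^ 2 - ξ ^ 3 * κ * ζ⁻¹ - 2 * ξ ^ 3 * κ * ζ + ξ ^ 4, -κ * ζ⁻¹ - κ * ζ + 2 * ξ - ξ * κ ^ 2 + ξ ^ 2 * κ * ζ⁻¹ + ξ ^ 2 * κ * ζ - ξ ^ 3;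
        κ * ζ⁻¹ + κ * ζ - κ ^ 3 * ζ⁻¹ - κ ^ 3 * ζ - 2 * ξ + ξ * κ ^ 2 * ζ⁻¹ ^ 2 + 5 * ξ * κ ^ 2 - ξ * κ ^ 4 - 4 * ξ ^ 2 * κ * ζ⁻¹ - ξ ^ 2 * κ * ζ + 2 * ξ ^ 2 * κ ^ 3 * ζ⁻¹ + ξ ^ 2 * κ ^ 3 * ζ + ξ ^ 3 - ξ ^ 3 * κ ^ 2 * ζ⁻¹ ^ 2 - 2 * ξ ^ 3 * κ ^ 2 + ξ ^ 4 * κ * ζ⁻¹, 1 - κ ^ 2 * ζ⁻¹ ^ 2 - κ ^ 2 + 3 * ξ * κ * ζ⁻¹ - ξ * κ ^ 3 * ζ⁻¹ - ξ ^ 2 + ξ ^ 2 * κ ^ 2 * ζ⁻¹ ^ 2 + ξ ^ 2 * κ ^ 2 - ξ ^ 3 * κ * ζ⁻¹] := by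
  simp only [Matrix.SpecialLinearGroup.coe_mul, mu_coe, mu_inv_coe, mk_coe, mk_inv_coe,
    Matrix.mul_fin_two]
  ext i j
  fin_cases i <;> fin_cases j <;> simp <;> field_simp <;> ring

theorem tr_b (ξ κ ζ z : ℝ) (hζ : ζ ≠ 0) (hz : z = ζ + ζ⁻¹) :
    ((mu ξ)⁻¹ * (mk κ ζ hζ)⁻¹ * (mk κ ζ hζ)⁻¹ * (mu ξ)⁻¹ * mk κ ζ hζ * mu ξ * mu ξ * mk κ ζ hζ * mk κ ζ hζ * mk κ ζ hζ * mu ξ * mu ξ * mu ξ * mk κ ζ hζ * mk κ ζ hζ * mu ξ : Matrix.SpecialLinearGroup (Fin 2) ℝ).1.trace =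
      2 - 4 * κ ^ 2 + 1 * κ ^ 4 + 4 * ξ * κ * z - 2 * ξ * κ ^ 3 * z - 1 * ξ ^ 2 * z ^ 2 + 1 * ξ ^ 2 * κ ^ 2 + 1 * ξ ^ 2 * κ ^ 2 * z ^ 2 - 1 * ξ ^ 3 * κ * z := by
  have e : ((mu ξ)⁻¹ * (mk κ ζ hζ)⁻¹ * (mk κ ζ hζ)⁻¹ * (mu ξ)⁻¹ * mk κ ζ hζ * mu ξ * mu ξ * mk κ ζ hζ * mk κ ζ hζ * mk κ ζ hζ * mu ξ * mu ξ * mu ξ * mk κ ζ hζ * mk κ ζ hζ * mu ξ : Matrix.SpecialLinearGroup (Fin 2) ℝ) =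
    ((mu ξ)⁻¹ * (mk κ ζ hζ)⁻¹ * (mk κ ζ hζ)⁻¹ * (mu ξ)⁻¹ * mk κ ζ hζ * mu ξ * mu ξ * mk κ ζ hζ) * (mk κ ζ hζ * mk κ ζ hζ * mu ξ * mu ξ * mu ξ * mk κ ζ hζ * mk κ ζ hζ * mu ξ) := by
    simp only [mul_assoc]
  rw [e, Matrix.SpecialLinearGroup.coe_mul, half3, half4, Matrix.mul_fin_two,
    Matrix.trace_fin_two_of, hz]
  field_simp
  ring

theorem half5 (ξ κ ζ : ℝ) (hζ : ζ ≠ 0) :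
    ((mu ξ)⁻¹ * (mk κ ζ hζ)⁻¹ * (mk κ ζ hζ)⁻¹ * (mk κ ζ hζ)⁻¹ * (mu ξ)⁻¹ * (mu ξ)⁻¹ : Matrix.SpecialLinearGroup (Fin 2) ℝ).1 =
      !![ζ⁻¹ - κ ^ 2 * ζ⁻¹ + ξ * κ, κ - ξ * ζ⁻¹ + ξ * κ ^ 2 * ζ⁻¹ - ξ ^ 2 * κ;
        -2 * κ + κ ^ 3 + ξ * ζ⁻¹ + ξ * ζ - ξ * κ ^ 2 * ζ⁻¹ - ξ * κ ^ 2 * ζ + ξ ^ 2 * κ, ζ - κ ^ 2 * ζ + 3 * ξ * κ - ξ * κ ^ 3 - ξ ^ 2 * ζ⁻¹ - ξ ^ 2 * ζ + ξ ^ 2 * κ ^ 2 * ζ⁻¹ + ξ ^ 2 * κ ^ 2 * ζ - ξ ^ 3 * κ] := by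
  simp only [Matrix.SpecialLinearGroup.coe_mul, mu_coe, mu_inv_coe, mk_coe, mk_inv_coe,
    Matrix.mul_fin_two]
  ext i j
  fin_cases i <;> fin_cases j <;> simp <;> field_simp <;> ring

theorem half6 (ξ κ ζ : ℝ) (hζ : ζ ≠ 0) :
    ((mk κ ζ hζ)⁻¹ * mu ξ * mk κ ζ hζ * mk κ ζ hζ * mu ξ : Matrix.SpecialLinearGroup (Fin 2) ℝ).1 =
      !![κ - κ * ζ ^ 2 - κ ^ 3 + ξ * ζ + ξ * κ ^ 2 * ζ⁻¹ + ξ * κ ^ 2 * ζ - ξ ^ 2 * κ, -ζ - κ ^ 2 * ζ⁻¹ + ξ * κ;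
        ζ⁻¹ - κ ^ 2 * ζ⁻¹ + ξ * κ * ζ⁻¹ ^ 2 + ξ * κ - ξ ^ 2 * ζ⁻¹, -κ * ζ⁻¹ ^ 2 + ξ * ζ⁻¹] := by
  simp only [Matrix.SpecialLinearGroup.coe_mul, mu_coe, mu_inv_coe, mk_coe, mk_inv_coe,
    Matrix.mul_fin_two]
  ext i j
  fin_cases i <;> fin_cases j <;> simp <;> field_simp <;> ring

theorem tr_g (ξ κ ζ z : ℝ) (hζ : ζ ≠ 0) (hz : z = ζ + ζ⁻¹) :
    ((mu ξ)⁻¹ * (mk κ ζ hζ)⁻¹ * (mk κ ζ hζ)⁻¹ * (mk κ ζ hζ)⁻¹ * (mu ξ)⁻¹ * (mu ξ)⁻¹ * (mk κ ζ hζ)⁻¹ * mu ξ * mk κ ζ hζ * mk κ ζ hζ * mu ξ : Matrix.SpecialLinearGroup (Fin 2) ℝ).1.trace =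
      1 * κ * z + 3 * ξ - 1 * ξ * z ^ 2 - 1 * ξ * κ ^ 2 + 1 * ξ ^ 2 * κ * z - 1 * ξ ^ 3 := by
  have e : ((mu ξ)⁻¹ * (mk κ ζ hζ)⁻¹ * (mk κ ζ hζ)⁻¹ * (mk κ ζ hζ)⁻¹ * (mu ξ)⁻¹ * (mu ξ)⁻¹ * (mk κ ζ hζ)⁻¹ * mu ξ * mk κ ζ hζ * mk κ ζ hζ * mu ξ : Matrix.SpecialLinearGroup (Fin 2) ℝ) =
    ((mu ξ)⁻¹ * (mk κ ζ hζ)⁻¹ * (mk κ ζ hζ)⁻¹ * (mk κ ζ hζ)⁻¹ * (mu ξ)⁻¹ * (mu ξ)⁻¹) * ((mk κ ζ hζ)⁻¹ * mu ξ * mk κ ζ hζ * mk κ ζ hζ * mu ξ) := by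
    simp only [mul_assoc]
  rw [e, Matrix.SpecialLinearGroup.coe_mul, half5, half6, Matrix.mul_fin_two,
    Matrix.trace_fin_two_of, hz]
  field_simp
  ring

theorem half7 (ξ κ ζ : ℝ) (hζ : ζ ≠ 0) :
    ((mu ξ)⁻¹ * (mk κ ζ hζ)⁻¹ * (mk κ ζ hζ)⁻¹ : Matrix.SpecialLinearGroup (Fin 2) ℝ).1 =
      !![κ * ζ⁻¹, -1;
        1 - κ ^ 2 + ξ * κ * ζ⁻¹, κ * ζ - ξ] := by
  simp only [Matrix.SpecialLinearGroup.coe_mul, mu_coe, mu_inv_coe, mk_coe, mk_inv_coe,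
    Matrix.mul_fin_two]
  ext i j
  fin_cases i <;> fin_cases j <;> simp <;> field_simp <;> ring

theorem half8 (ξ κ ζ : ℝ) (hζ : ζ ≠ 0) :
    ((mu ξ)⁻¹ * mk κ ζ hζ : Matrix.SpecialLinearGroup (Fin 2) ℝ).1 =
      !![-ζ⁻¹, κ;
        -ξ * ζ⁻¹, -ζ + ξ * κ] := by
  simp only [Matrix.SpecialLinearGroup.coe_mul, mu_coe, mu_inv_coe, mk_coe, mk_inv_coe,
    Matrix.mul_fin_two]
  ext i j
  fin_cases i <;> fin_cases j <;> simp <;> field_simp <;> ring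

theorem tr_h (ξ κ ζ z : ℝ) (hζ : ζ ≠ 0) (hz : z = ζ + ζ⁻¹) :
    ((mu ξ)⁻¹ * (mk κ ζ hζ)⁻¹ * (mk κ ζ hζ)⁻¹ * (mu ξ)⁻¹ * mk κ ζ hζ : Matrix.SpecialLinearGroup (Fin 2) ℝ).1.trace =
      3 * κ - 1 * κ * z ^ 2 - 1 * κ ^ 3 + 1 * ξ * z + 1 * ξ * κ ^ 2 * z - 1 * ξ ^ 2 * κ := by
  have e : ((mu ξ)⁻¹ * (mk κ ζ hζ)⁻¹ * (mk κ ζ hζ)⁻¹ * (mu ξ)⁻¹ * mk κ ζ hζ : Matrix.SpecialLinearGroup (Fin 2) ℝ) =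
    ((mu ξ)⁻¹ * (mk κ ζ hζ)⁻¹ * (mk κ ζ hζ)⁻¹) * ((mu ξ)⁻¹ * mk κ ζ hζ) := by
    simp only [mul_assoc]
  rw [e, Matrix.SpecialLinearGroup.coe_mul, half7, half8, Matrix.mul_fin_two,
    Matrix.trace_fin_two_of, hz]
  field_simp
  ring

theorem half9 (ξ κ ζ : ℝ) (hζ : ζ ≠ 0) :
    (mu ξ * mu ξ * mk κ ζ hζ * mk κ ζ hζ * mu ξ * (mk κ ζ hζ)⁻¹ : Matrix.SpecialLinearGroup (Fin 2) ℝ).1 =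
      !![-ζ⁻¹ - κ ^ 2 * ζ - ξ * κ * ζ⁻¹ ^ 2 + 2 * ξ * κ - ξ * κ ^ 3 + ξ ^ 2 * ζ⁻¹ + ξ ^ 2 * κ ^ 2 * ζ⁻¹ + ξ ^ 2 * κ ^ 2 * ζ - ξ ^ 3 * κ, κ * ζ ^ 2 - 2 * ξ * ζ + ξ * κ ^ 2 * ζ - ξ ^ 2 * κ - ξ ^ 2 * κ * ζ ^ 2 + ξ ^ 3 * ζ;
        -κ * ζ⁻¹ ^ 2 + κ - κ ^ 3 + ξ * ζ⁻¹ + ξ * κ ^ 2 * ζ⁻¹ + ξ * κ ^ 2 * ζ - ξ ^ 2 * κ, -ζ + κ ^ 2 * ζ - ξ * κ - ξ * κ * ζ ^ 2 + ξ ^ 2 * ζ] := by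
  simp only [Matrix.SpecialLinearGroup.coe_mul, mu_coe, mu_inv_coe, mk_coe, mk_inv_coe,
    Matrix.mul_fin_two]
  ext i j
  fin_cases i <;> fin_cases j <;> simp <;> field_simp <;> ring

theorem half10 (ξ κ ζ : ℝ) (hζ : ζ ≠ 0) :
    ((mu ξ)⁻¹ * (mu ξ)⁻¹ * (mk κ ζ hζ)⁻¹ * mu ξ * mk κ ζ hζ * mk κ ζ hζ * mu ξ : Matrix.SpecialLinearGroup (Fin 2) ℝ).1 =
      !![-κ + κ * ζ ^ 2 + κ ^ 3 + ξ * ζ⁻¹ - ξ * ζ - 2 * ξ * κ ^ 2 * ζ⁻¹ - ξ * κ ^ 2 * ζ + ξ ^ 2 * κ * ζ⁻¹ ^ 2 + 2 * ξ ^ 2 * κ - ξ ^ 3 * ζ⁻¹, ζ + κ ^ 2 * ζ⁻¹ - ξ * κ * ζ⁻¹ ^ 2 - ξ * κ + ξ ^ 2 * ζ⁻¹;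
        -ζ⁻¹ + κ ^ 2 * ζ⁻¹ - ξ * κ * ζ⁻¹ ^ 2 - 2 * ξ * κ + ξ * κ * ζ ^ 2 + ξ * κ ^ 3 + 2 * ξ ^ 2 * ζ⁻¹ - ξ ^ 2 * ζ - 2 * ξ ^ 2 * κ ^ 2 * ζ⁻¹ - ξ ^ 2 * κ ^ 2 * ζ + ξ ^ 3 * κ * ζ⁻¹ ^ 2 + 2 * ξ ^ 3 * κ - ξ ^ 4 * ζ⁻¹, κ * ζ⁻¹ ^ 2 - ξ * ζ⁻¹ + ξ * ζ + ξ * κ ^ 2 * ζ⁻¹ - ξ ^ 2 * κ * ζ⁻¹ ^ 2 - ξ ^ 2 * κ + ξ ^ 3 * ζ⁻¹] := by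
  simp only [Matrix.SpecialLinearGroup.coe_mul, mu_coe, mu_inv_coe, mk_coe, mk_inv_coe,
    Matrix.mul_fin_two]
  ext i j
  fin_cases i <;> fin_cases j <;> simp <;> field_simp <;> ring

theorem tr_ag (ξ κ ζ z : ℝ) (hζ : ζ ≠ 0) (hz : z = ζ + ζ⁻¹) :
    (mu ξ * mu ξ * mk κ ζ hζ * mk κ ζ hζ * mu ξ * (mk κ ζ hζ)⁻¹ * (mu ξ)⁻¹ * (mu ξ)⁻¹ * (mk κ ζ hζ)⁻¹ * mu ξ * mk κ ζ hζ * mk κ ζ hζ * mu ξ : Matrix.SpecialLinearGroup (Fin 2) ℝ).1.trace =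
      - 1 * κ * z + 4 * κ ^ 3 * z - 1 * κ ^ 3 * z ^ 3 - 1 * κ ^ 5 * z + 7 * ξ - 1 * ξ * z ^ 2 - 14 * ξ * κ ^ 2 - 1 * ξ * κ ^ 2 * z ^ 2 + 1 * ξ * κ ^ 2 * z ^ 4 + 7 * ξ * κ ^ 4 + 1 * ξ * κ ^ 4 * z ^ 2 - 1 * ξ * κ ^ 6 + 18 * ξ ^ 2 * κ * z - 4 * ξ ^ 2 * κ * z ^ 3 - 16 * ξ ^ 2 * κ ^ 3 * z + 1 * ξ ^ 2 * κ ^ 3 * z ^ 3 + 3 * ξ ^ 2 * κ ^ 5 * z - 14 * ξ ^ 3 + 3 * ξ ^ 3 * z ^ 2 + 14 * ξ ^ 3 * κ ^ 2 + 7 * ξ ^ 3 * κ ^ 2 * z ^ 2 - 1 * ξ ^ 3 * κ ^ 2 * z ^ 4 - 3 * ξ ^ 3 * κ ^ 4 - 3 * ξ ^ 3 * κ ^ 4 * z ^ 2 - 15 * ξ ^ 4 * κ * z + 2 * ξ ^ 4 * κ * z ^ 3 + 6 * ξ ^ 4 * κ ^ 3 * z + 1 * ξ ^ 4 * κ ^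 3 * z ^ 3 + 7 * ξ ^ 5 - 1 * ξ ^ 5 * z ^ 2 - 3 * ξ ^ 5 * κ ^ 2 - 3 * ξ ^ 5 * κ ^ 2 * z ^ 2 + 3 * ξ ^ 6 * κ * z - 1 * ξ ^ 7 := by
  have e : (mu ξ * mu ξ * mk κ ζ hζ * mk κ ζ hζ * mu ξ * (mk κ ζ hζ)⁻¹ * (mu ξ)⁻¹ * (mu ξ)⁻¹ * (mk κ ζ hζ)⁻¹ * mu ξ * mk κ ζ hζ * mk κ ζ hζ * mu ξ : Matrix.SpecialLinearGroup (Fin 2) ℝ) =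
    (mu ξ * mu ξ * mk κ ζ hζ * mk κ ζ hζ * mu ξ * (mk κ ζ hζ)⁻¹) * ((mu ξ)⁻¹ * (mu ξ)⁻¹ * (mk κ ζ hζ)⁻¹ * mu ξ * mk κ ζ hζ * mk κ ζ hζ * mu ξ) := by
    simp only [mul_assoc]
  rw [e, Matrix.SpecialLinearGroup.coe_mul, half9, half10, Matrix.mul_fin_two,
    Matrix.trace_fin_two_of, hz]
  field_simp
  ring

theorem half11 (ξ κ ζ : ℝ) (hζ : ζ ≠ 0) :
    ((mu ξ)⁻¹ * (mk κ ζ hζ)⁻¹ * (mk κ ζ hζ)⁻¹ * (mu ξ)⁻¹ * mk κ ζ hζ * mu ξ : Matrix.SpecialLinearGroup (Fin 2) ℝ).1 =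
      !![ζ + κ ^ 2 * ζ⁻¹ - ξ * κ * ζ⁻¹ ^ 2 - ξ * κ + ξ ^ 2 * ζ⁻¹, κ * ζ⁻¹ ^ 2 - ξ * ζ⁻¹;
        κ - κ * ζ ^ 2 - κ ^ 3 - ξ * ζ⁻¹ + ξ * ζ + 2 * ξ * κ ^ 2 * ζ⁻¹ + ξ * κ ^ 2 * ζ - ξ ^ 2 * κ * ζ⁻¹ ^ 2 - 2 * ξ ^ 2 * κ + ξ ^ 3 * ζ⁻¹, ζ⁻¹ - κ ^ 2 * ζ⁻¹ + ξ * κ * ζ⁻¹ ^ 2 + ξ * κ - ξ ^ 2 * ζ⁻¹] := by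
  simp only [Matrix.SpecialLinearGroup.coe_mul, mu_coe, mu_inv_coe, mk_coe, mk_inv_coe,
    Matrix.mul_fin_two]
  ext i j
  fin_cases i <;> fin_cases j <;> simp <;> field_simp <;> ring

theorem half12 (ξ κ ζ : ℝ) (hζ : ζ ≠ 0) :
    (mu ξ * mk κ ζ hζ * mk κ ζ hζ * mk κ ζ hζ * mu ξ * mu ξ * mk κ ζ hζ : Matrix.SpecialLinearGroup (Fin 2) ℝ).1 =
      !![2 * κ * ζ⁻¹ - κ ^ 3 * ζ⁻¹ - ξ * ζ⁻¹ ^ 2 - ξ + ξ * κ ^ 2 * ζ⁻¹ ^ 2 + ξ * κ ^ 2 - ξ ^ 2 * κ * ζ⁻¹, 1 - 3 * κ ^ 2 + κ ^ 4 + ξ * κ * ζ⁻¹ + 4 * ξ * κ * ζ - ξ * κ ^ 3 * ζ⁻¹ - 2 * ξ * κ ^ 3 * ζ - ξ ^ 2 - ξ ^ 2 * ζ ^ 2 + 2 * ξ ^ 2 * κ ^ 2 + ξ ^ 2 * κ ^ 2 * ζ ^ 2 - ξ ^ 3 * κ * ζ;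
        -1 + κ ^ 2 - ξ * κ * ζ⁻¹, 2 * κ * ζ - κ ^ 3 * ζ - ξ * ζ ^ 2 + ξ * κ ^ 2 + ξ * κ ^ 2 * ζ ^ 2 - ξ ^ 2 * κ * ζ] := by
  simp only [Matrix.SpecialLinearGroup.coe_mul, mu_coe, mu_inv_coe, mk_coe, mk_inv_coe,
    Matrix.mul_fin_two]
  ext i j
  fin_cases i <;> fin_cases j <;> simp <;> field_simp <;> ring

theorem tr_bh (ξ κ ζ z : ℝ) (hζ : ζ ≠ 0) (hz : z = ζ + ζ⁻¹) :
    ((mu ξ)⁻¹ * (mk κ ζ hζ)⁻¹ * (mk κ ζ hζ)⁻¹ * (mu ξ)⁻¹ * mk κ ζ hζ * mu ξ * mu ξ * mk κ ζ hζ * mk κ ζ hζ * mk κ ζ hζ * mu ξ * mu ξ * mk κ ζ hζ : Matrix.SpecialLinearGroup (Fin 2) ℝ).1.trace =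
      7 * κ - 1 * κ * z ^ 2 - 14 * κ ^ 3 + 3 * κ ^ 3 * z ^ 2 + 7 * κ ^ 5 - 1 * κ ^ 5 * z ^ 2 - 1 * κ ^ 7 - 1 * ξ * z + 18 * ξ * κ ^ 2 * z - 4 * ξ * κ ^ 2 * z ^ 3 - 15 * ξ * κ ^ 4 * z + 2 * ξ * κ ^ 4 * z ^ 3 + 3 * ξ * κ ^ 6 * z - 14 * ξ ^ 2 * κ - 1 * ξ ^ 2 * κ * z ^ 2 + 1 * ξ ^ 2 * κ * z ^ 4 + 14 * ξ ^ 2 * κ ^ 3 + 7 * ξ ^ 2 * κ ^ 3 * z ^ 2 - 1 * ξ ^ 2 * κ ^ 3 * z ^ 4 - 3 * ξ ^ 2 * κ ^ 5 - 3 * ξ ^ 2 * κ ^ 5 * z ^ 2 + 4 * ξ ^ 3 * z - 1 * ξ ^ 3 * z ^ 3 - 16 * ξ ^ 3 * κ ^ 2 * z + 1 * ξ ^ 3 * κ ^ 2 * z ^ 3 + 6 * ξ ^ 3 * κ ^ 4 * z + 1 * ξ ^ 3 * κ ^ 4 * z ^ 3 + 7 * ξ ^ 4 * κ + 1 * ξ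 ^ 4 * κ * z ^ 2 - 3 * ξ ^ 4 * κ ^ 3 - 3 * ξ ^ 4 * κ ^ 3 * z ^ 2 - 1 * ξ ^ 5 * z + 3 * ξ ^ 5 * κ ^ 2 * z - 1 * ξ ^ 6 * κ := by
  have e : ((mu ξ)⁻¹ * (mk κ ζ hζ)⁻¹ * (mk κ ζ hζ)⁻¹ * (mu ξ)⁻¹ * mk κ ζ hζ * mu ξ * mu ξ * mk κ ζ hζ * mk κ ζ hζ * mk κ ζ hζ * mu ξ * mu ξ * mk κ ζ hζ : Matrix.SpecialLinearGroup (Fin 2) ℝ) =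
    ((mu ξ)⁻¹ * (mk κ ζ hζ)⁻¹ * (mk κ ζ hζ)⁻¹ * (mu ξ)⁻¹ * mk κ ζ hζ * mu ξ) * (mu ξ * mk κ ζ hζ * mk κ ζ hζ * mk κ ζ hζ * mu ξ * mu ξ * mk κ ζ hζ) := by
    simp only [mul_assoc]
  rw [e, Matrix.SpecialLinearGroup.coe_mul, half11, half12, Matrix.mul_fin_two,
    Matrix.trace_fin_two_of, hz]
  field_simp
  ring

theorem half13 (ξ κ ζ : ℝ) (hζ : ζ ≠ 0) :
    (mu ξ * mu ξ * mu ξ * mk κ ζ hζ * mk κ ζ hζ * mk κ ζ hζ : Matrix.SpecialLinearGroup (Fin 2) ℝ).1 =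
      !![ζ⁻¹ - κ ^ 2 * ζ⁻¹ + 2 * ξ * κ - ξ ^ 2 * ζ⁻¹ + ξ ^ 2 * κ ^ 2 * ζ⁻¹ - ξ ^ 3 * κ, -2 * κ + κ ^ 3 + 2 * ξ * ζ - 2 * ξ * κ ^ 2 * ζ + 2 * ξ ^ 2 * κ - ξ ^ 2 * κ ^ 3 - ξ ^ 3 * ζ + ξ ^ 3 * κ ^ 2 * ζ;
        κ - ξ * ζ⁻¹ + ξ * κ ^ 2 * ζ⁻¹ - ξ ^ 2 * κ, ζ - κ ^ 2 * ζ + 2 * ξ * κ - ξ * κ ^ 3 - ξ ^ 2 * ζ + ξ ^ 2 * κ ^ 2 * ζ] := by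
  simp only [Matrix.SpecialLinearGroup.coe_mul, mu_coe, mu_inv_coe, mk_coe, mk_inv_coe,
    Matrix.mul_fin_two]
  ext i j
  fin_cases i <;> fin_cases j <;> simp <;> field_simp <;> ring

theorem half14 (ξ κ ζ : ℝ) (hζ : ζ ≠ 0) :
    (mu ξ * mu ξ * mk κ ζ hζ * (mu ξ)⁻¹ * (mk κ ζ hζ)⁻¹ * (mk κ ζ hζ)⁻¹ : Matrix.SpecialLinearGroup (Fin 2) ℝ).1 =
      !![-ζ + κ ^ 2 * ζ + ξ * κ * ζ⁻¹ ^ 2 - 2 * ξ * κ + ξ * κ ^ 3 + ξ ^ 2 * ζ - ξ ^ 2 * κ ^ 2 * ζ⁻¹ - ξ ^ 2 * κ ^ 2 * ζ + ξ ^ 3 * κ, -κ * ζ ^ 2 - ξ * ζ⁻¹ + ξ * ζ - ξ * κ ^ 2 * ζ + ξ ^ 2 * κ + ξ ^ 2 * κ * ζ ^ 2 - ξ ^ 3 * ζ;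
        κ * ζ⁻¹ ^ 2 - κ + κ ^ 3 + ξ * ζ - ξ * κ ^ 2 * ζ⁻¹ - ξ * κ ^ 2 * ζ + ξ ^ 2 * κ, -ζ⁻¹ - κ ^ 2 * ζ + ξ * κ + ξ * κ * ζ ^ 2 - ξ ^ 2 * ζ] := by
  simp only [Matrix.SpecialLinearGroup.coe_mul, mu_coe, mu_inv_coe, mk_coe, mk_inv_coe,
    Matrix.mul_fin_two]
  ext i j
  fin_cases i <;> fin_cases j <;> simp <;> field_simp <;> ring

theorem half15 (ξ κ ζ : ℝ) (hζ : ζ ≠ 0) :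
    ((mk κ ζ hζ)⁻¹ * (mk κ ζ hζ)⁻¹ * (mu ξ)⁻¹ * mk κ ζ hζ * mu ξ * mu ξ : Matrix.SpecialLinearGroup (Fin 2) ℝ).1 =
      !![-ζ⁻¹ + κ ^ 2 * ζ⁻¹ - 2 * ξ * κ + ξ * κ * ζ ^ 2 + ξ * κ ^ 3 + ξ ^ 2 * ζ⁻¹ - ξ ^ 2 * κ ^ 2 * ζ⁻¹ - ξ ^ 2 * κ ^ 2 * ζ + ξ ^ 3 * κ, κ - κ * ζ ^ 2 - κ ^ 3 - ξ * ζ⁻¹ + ξ * κ ^ 2 * ζ⁻¹ + ξ * κ ^ 2 * ζ - ξ ^ 2 * κ;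
        κ * ζ⁻¹ ^ 2 - ξ * ζ⁻¹ + ξ * ζ + ξ * κ ^ 2 * ζ⁻¹ - ξ ^ 2 * κ * ζ⁻¹ ^ 2 - ξ ^ 2 * κ + ξ ^ 3 * ζ⁻¹, -ζ - κ ^ 2 * ζ⁻¹ + ξ * κ * ζ⁻¹ ^ 2 + ξ * κ - ξ ^ 2 * ζ⁻¹] := by
  simp only [Matrix.SpecialLinearGroup.coe_mul, mu_coe, mu_inv_coe, mk_coe, mk_inv_coe,
    Matrix.mul_fin_two]
  ext i j
  fin_cases i <;> fin_cases j <;> simp <;> field_simp <;> ring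

theorem half16 (ξ κ ζ : ℝ) (hζ : ζ ≠ 0) :
    (mk κ ζ hζ * mk κ ζ hζ * mk κ ζ hζ * mu ξ * mu ξ * mu ξ : Matrix.SpecialLinearGroup (Fin 2) ℝ).1 =
      !![ζ - κ ^ 2 * ζ + 2 * ξ * κ - ξ ^ 2 * ζ + ξ ^ 2 * κ ^ 2 * ζ - ξ ^ 3 * κ, -κ + ξ * ζ - ξ * κ ^ 2 * ζ + ξ ^ 2 * κ;
        2 * κ - κ ^ 3 - 2 * ξ * ζ⁻¹ + 2 * ξ * κ ^ 2 * ζ⁻¹ - 2 * ξ ^ 2 * κ + ξ ^ 2 * κ ^ 3 + ξ ^ 3 * ζ⁻¹ - ξ ^ 3 * κ ^ 2 * ζ⁻¹, ζ⁻¹ - κ ^ 2 * ζ⁻¹ + 2 * ξ * κ - ξ * κ ^ 3 - ξ ^ 2 * ζ⁻¹ + ξ ^ 2 * κ ^ 2 * ζ⁻¹] := by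
  simp only [Matrix.SpecialLinearGroup.coe_mul, mu_coe, mu_inv_coe, mk_coe, mk_inv_coe,
    Matrix.mul_fin_two]
  ext i j
  fin_cases i <;> fin_cases j <;> simp <;> field_simp <;> ring

theorem star_of_f (ξ κ ζ z : ℝ) (hζ : ζ ≠ 0) (hz : z = ζ + ζ⁻¹)
    (hf : ξ * κ * (1 - (ξ ^ 2 + κ ^ 2) + ξ ^ 2 * κ ^ 2) * z ^ 2 +
      ((ξ ^ 2 + κ ^ 2) ^ 2 - 2 * (ξ ^ 2 + κ ^ 2) + 5 * (ξ ^ 2 * κ ^ 2) -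
        2 * (ξ ^ 2 * κ ^ 2) * (ξ ^ 2 + κ ^ 2)) * z +
      ξ * κ * ((ξ ^ 2 + κ ^ 2) ^ 2 - 5 * (ξ ^ 2 + κ ^ 2) + 5) = 0) :
    (mu ξ * mu ξ * mu ξ * mk κ ζ hζ * mk κ ζ hζ * mk κ ζ hζ) * (mu ξ * mu ξ * mk κ ζ hζ * (mu ξ)⁻¹ * (mk κ ζ hζ)⁻¹ * (mk κ ζ hζ)⁻¹) =
      ((mk κ ζ hζ)⁻¹ * (mk κ ζ hζ)⁻¹ * (mu ξ)⁻¹ * mk κ ζ hζ * mu ξ * mu ξ) * (mk κ ζ hζ * mk κ ζ hζ * mk κ ζ hζ * mu ξ * mu ξ * mu ξ) := by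
  apply Subtype.ext
  rw [← sub_eq_zero]
  rw [Matrix.SpecialLinearGroup.coe_mul, Matrix.SpecialLinearGroup.coe_mul _ (mk κ ζ hζ * mk κ ζ hζ * mk κ ζ hζ * mu ξ * mu ξ * mu ξ),
    half13, half14, half15, half16]
  have : ∀ M : Matrix (Fin 2) (Fin 2) ℝ, M = (ξ * κ * (1 - (ξ ^ 2 + κ ^ 2) + ξ ^ 2 * κ ^ 2) * z ^ 2 +
      ((ξ ^ 2 + κ ^ 2) ^ 2 - 2 * (ξ ^ 2 + κ ^ 2) + 5 * (ξ ^ 2 * κ ^ 2) -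
        2 * (ξ ^ 2 * κ ^ 2) * (ξ ^ 2 + κ ^ 2)) * z +
      ξ * κ * ((ξ ^ 2 + κ ^ 2) ^ 2 - 5 * (ξ ^ 2 + κ ^ 2) + 5)) •
      (!![ξ, -1; 1, 0] * !![0, ζ; -ζ⁻¹, κ] - !![0, ζ; -ζ⁻¹, κ] * !![ξ, -1; 1, 0]) → M = 0 := by
    intro M hM
    rw [hM, hf, zero_smul]
  apply this
  rw [hz]
  simp only [Matrix.mul_fin_two]
  ext i j
  fin_cases i <;> fin_cases j <;> simp <;> field_simp <;> ring

theorem rel_of_star {G : Type*} [Group G] (u k : G)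
    (h : (u * u * u * k * k * k) * (u * u * k * u⁻¹ * k⁻¹ * k⁻¹) =
      (k⁻¹ * k⁻¹ * u⁻¹ * k * u * u) * (k * k * k * u * u * u)) :
    u * u * u * k * k * k * u * u * k * u⁻¹ * k⁻¹ * k⁻¹ * u⁻¹ * u⁻¹ * u⁻¹ * k⁻¹ * k⁻¹ *
      k⁻¹ * u⁻¹ * u⁻¹ * k⁻¹ * u * k * k = 1 := by
  have h' := mul_inv_eq_one.2 h
  rw [← h']
  simp only [mul_assoc, mul_inv_rev, inv_inv]

theorem five_words {G : Type*} [Group G] (u k : G) (hu : u * u * u * u * u = 1)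
    (hk : k * k * k = 1) :
    u⁻¹ * k⁻¹ * k⁻¹ * u⁻¹ * k * u * u * k * k * k * u * u * u * k * k * u = u⁻¹ * k ∧
    u⁻¹ * k⁻¹ * k⁻¹ * u⁻¹ * k = (u⁻¹ * k) ^ 2 ∧
    u⁻¹ * k⁻¹ * k⁻¹ * k⁻¹ * u⁻¹ * u⁻¹ * k⁻¹ * u * k * k * u = u * u * k * k * u * k * k * u := by
  have hK : k⁻¹ * k⁻¹ = k := by
    calc k⁻¹ * k⁻¹ = k⁻¹ * k⁻¹ * (k * k * k) := by rw [hk, mul_one]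
      _ = k := by group
  have hK2 : k * k = k⁻¹ := by
    calc k * k = k * k * k * k⁻¹ := by group
      _ = k⁻¹ := by rw [hk, one_mul]
  have hU : u⁻¹ * u⁻¹ * u⁻¹ = u * u := by
    calc u⁻¹ * u⁻¹ * u⁻¹ = u⁻¹ * u⁻¹ * u⁻¹ * (u * u * u * u * u) := by rw [hu, mul_one]
      _ = u * u := by simp only [mul_assoc, inv_mul_cancel_left]
  refine ⟨?_, ?_, ?_⟩
  · calc _ = u⁻¹ * (k⁻¹ * k⁻¹) * u⁻¹ * k * (u * u) * (k * k * k) * (u * u * u) * (k * k) * u := by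
          simp only [mul_assoc]
      _ = u⁻¹ * k * u⁻¹ * k * (u * u * u * u * u) * (k * k) * u := by
          rw [hK, hk]; simp only [mul_assoc, one_mul]
      _ = _ := by rw [hu, hK2]; group
  · calc _ = u⁻¹ * (k⁻¹ * k⁻¹) * u⁻¹ * k := by simp only [mul_assoc]
      _ = _ := by rw [hK, pow_two]; simp only [mul_assoc]
  · calc _ = u⁻¹ * (k⁻¹ * k⁻¹) * k⁻¹ * u⁻¹ * u⁻¹ * k⁻¹ * u * (k * k) * u := by simp only [mul_assoc]
      _ = (u⁻¹ * u⁻¹ * u⁻¹) * k⁻¹ * u * k⁻¹ * u := by rw [hK, hK2]; group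
      _ = _ := by rw [hU, ← hK2]; simp only [mul_assoc]

theorem case_five (m : ℕ) (hm : 3 ≤ m) :
    Infinite (PresentedGroup (pretzelRels (2 * (2 : ℕ) + 1) (2 * m + 1)
      (2 * ((2 * (2 : ℕ) + 1) + (2 * m + 1)) - 1))) := by
  obtain ⟨M, rfl⟩ : ∃ M, m = M + 1 := ⟨m - 1, by omega⟩
  have hM : (2 : ℝ) ≤ M := by exact_mod_cast (show 2 ≤ M by omega)
  -- the golden ratio inverse
  obtain ⟨ξ, hξ⟩ : ∃ ξ, ξ = (√5 - 1) / 2 := ⟨_, rfl⟩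
  have h5 := Real.sq_sqrt (show (0 : ℝ) ≤ 5 by norm_num)
  have hξ2 : ξ ^ 2 = 1 - ξ := by rw [hξ]; linear_combination h5 / 4
  have h5l : 2 < √5 := by rw [Real.lt_sqrt] <;> norm_num
  have h5u : √5 < 3 := by rw [Real.sqrt_lt'] <;> norm_num
  have hξ0 : 0 < ξ := by rw [hξ]; linarith
  have hξ1 : ξ < 1 := by rw [hξ]; linarith
  obtain ⟨ψ, hψ⟩ : ∃ ψ, ψ = Real.pi - Real.pi / M := ⟨_, rfl⟩
  have hpi := Real.pi_pos
  have hq0 : 0 < Real.pi / M := by positivity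
  have hq1 : Real.pi / M ≤ Real.pi / 2 := by gcongr
  have hX0 : Real.cos ψ ≤ 0 :=
    Real.cos_nonpos_of_pi_div_two_le_of_le (by rw [hψ]; linarith) (by rw [hψ]; linarith)
  have hX1 : -1 < Real.cos ψ := by
    rw [← Real.cos_pi]
    exact Real.cos_lt_cos_of_nonneg_of_le_pi (by rw [hψ]; linarith) le_rfl (by rw [hψ]; linarith)
  obtain ⟨c, hc⟩ : ∃ c, c = 1 + (1 - 2 * Real.cos ψ) / ξ := ⟨_, rfl⟩
  have hc2 : 2 < c := by
    have : 1 < (1 - 2 * Real.cos ψ) / ξ := by rw [lt_div_iff₀ hξ0]; linarith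
    linarith
  have hcξ : c * ξ = ξ + 1 - 2 * Real.cos ψ := by rw [hc]; field_simp; ring
  obtain ⟨Y, hY⟩ : ∃ Y, Y = (1 + √(1 + 4 * c)) / 2 := ⟨_, rfl⟩
  have hsq := Real.sq_sqrt (show (0 : ℝ) ≤ 1 + 4 * c by linarith)
  have hYY : Y ^ 2 - Y = c := by rw [hY]; linear_combination hsq / 4
  have hY2 : 2 < Y := by
    have : 3 < √(1 + 4 * c) := by rw [Real.lt_sqrt] <;> linarith
    rw [hY]; linarith
  obtain ⟨z, hz⟩ : ∃ z, z = -ξ - Y := ⟨_, rfl⟩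
  obtain ⟨ζ, hζ, hzζ⟩ := exists_zeta z (by rw [hz]; nlinarith)
  have hu5 : mu ξ * mu ξ * mu ξ * mu ξ * mu ξ = 1 := by
    apply Subtype.ext
    simp only [Matrix.SpecialLinearGroup.coe_mul, mu_coe, Matrix.mul_fin_two,
      Matrix.SpecialLinearGroup.coe_one]
    ext i j
    fin_cases i <;> fin_cases j <;> simp <;> grind
  have hk3 : mk (-1) ζ hζ * mk (-1) ζ hζ * mk (-1) ζ hζ = 1 := by
    apply Subtype.ext
    simp only [Matrix.SpecialLinearGroup.coe_mul, mk_coe, Matrix.mul_fin_two,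
      Matrix.SpecialLinearGroup.coe_one]
    ext i j
    fin_cases i <;> fin_cases j <;> simp [hζ]
  obtain ⟨w1, w2, w3⟩ := five_words _ _ hu5 hk3
  have hR := rel_of_star _ _ (star_of_f ξ (-1) ζ z hζ hzζ (by grind))
  have htra := tr_a ξ (-1) ζ z hζ hzζ
  have htrb := tr_b ξ (-1) ζ z hζ hzζ
  set a := mu ξ * mu ξ * mk (-1) ζ hζ * mk (-1) ζ hζ * mu ξ * mk (-1) ζ hζ * mk (-1) ζ hζ * mu ξ
    with ha
  have hta : a.1.trace = 2 * Real.cos ψ := by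
    rw [htra]; grind
  have htb : ((mu ξ)⁻¹ * mk (-1) ζ hζ).1.trace = Y := by
    simp only [Matrix.SpecialLinearGroup.coe_mul, mu_inv_coe, mk_coe, Matrix.mul_fin_two,
      Matrix.trace_fin_two_of]
    linarith
  have hpow : ∀ j : ℕ, (a.1 ^ j).trace = 2 * Real.cos (j * ψ) := trace_pow_cos a.1 a.2 ψ hta
  have h4 : a.1.trace ^ 2 ≠ 4 := by
    rw [hta]; nlinarith
  have hMψ : (M : ℝ) * ψ = M * Real.pi - Real.pi := by
    rw [hψ]; field_simp
  have key : a ^ (M + 1) = a ∨ a ^ (M + 1) = -a := by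
    have e1 : ((M + 1 : ℕ) : ℝ) * ψ = ψ - Real.pi + M * Real.pi := by push_cast; linarith
    have e2 : ((M + 1 + 1 : ℕ) : ℝ) * ψ = 2 * ψ - Real.pi + M * Real.pi := by push_cast; linarith
    have t1 := hpow (M + 1)
    have t2 := hpow (M + 1 + 1)
    rw [e1, Real.cos_add_nat_mul_pi, Real.cos_sub_pi] at t1
    rw [e2, Real.cos_add_nat_mul_pi, Real.cos_sub_pi] at t2
    have t3 := hpow 2
    rw [pow_two] at t3
    push_cast at t3
    rcases neg_one_pow_eq_or ℝ M with h | h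
    · right
      apply eq_pow_of_trace a (-a) (M + 1) h4 (by simp)
      · rw [t1, h, Matrix.SpecialLinearGroup.coe_neg, Matrix.trace_neg, hta]; ring
      · rw [t2, h, mul_neg, Matrix.SpecialLinearGroup.coe_neg, Matrix.trace_neg,
          Matrix.SpecialLinearGroup.coe_mul, t3]; ring
    · left
      apply eq_pow_of_trace a a (M + 1) h4 rfl
      · rw [t1, h, hta]; ring
      · rw [t2, h, Matrix.SpecialLinearGroup.coe_mul, t3]; ring
  exact pretzel_infinite_of_rep (M + 1) 2 (mu ξ) (mk (-1) ζ hζ) a _ _ _ ha rfl rfl rfl hR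
    (by rw [w3]; exact key) (by rw [w1, w2]) (by rw [w1, htb]; exact hY2)

set_option maxHeartbeats 4000000 in
theorem comm_of_rel {G : Type*} [Group G] (u k a b g h : G)
    (ha : a = u * u * k * k * u * k * k * u)
    (hb : b = u⁻¹ * k⁻¹ * k⁻¹ * u⁻¹ * k * u * u * k * k * k * u * u * u * k * k * u)
    (hg : g = u⁻¹ * k⁻¹ * k⁻¹ * k⁻¹ * u⁻¹ * u⁻¹ * k⁻¹ * u * k * k * u)
    (hh : h = u⁻¹ * k⁻¹ * k⁻¹ * u⁻¹ * k)
    (hR : u * u * u * k * k * k * u * u * k * u⁻¹ * k⁻¹ * k⁻¹ * u⁻¹ * u⁻¹ * u⁻¹ * k⁻¹ * k⁻¹ *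
      k⁻¹ * u⁻¹ * u⁻¹ * k⁻¹ * u * k * k = 1) : a * g = g * a ∧ b * h = h * b := by
  constructor
  · have : a * g * (g * a)⁻¹ =
      (u⁻¹ * k⁻¹ * k⁻¹ * k⁻¹ * u⁻¹ * u⁻¹ * k⁻¹ * u * k * k) * (u * u * u * k * k * k * u * u * k * u⁻¹ * k⁻¹ * k⁻¹ * u⁻¹ * u⁻¹ * u⁻¹ * k⁻¹ * k⁻¹ *
      k⁻¹ * u⁻¹ * u⁻¹ * k⁻¹ * u * k * k)⁻¹ *
      (u⁻¹ * k⁻¹ * k⁻¹ * k⁻¹ * u⁻¹ * u⁻¹ * k⁻¹ * u * k * k)⁻¹ := by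
      rw [ha, hg]
      simp only [mul_assoc, mul_inv_rev, inv_inv, mul_inv_cancel_left, inv_mul_cancel_left, mul_inv_cancel, inv_mul_cancel, mul_one, one_mul]
    rw [hR] at this
    rw [← mul_inv_eq_one, this]; simp
  · have : b * h * (h * b)⁻¹ =
      (u⁻¹ * k⁻¹ * k⁻¹ * u⁻¹ * k * u⁻¹) * (u * u * u * k * k * k * u * u * k * u⁻¹ * k⁻¹ * k⁻¹ * u⁻¹ * u⁻¹ * u⁻¹ * k⁻¹ * k⁻¹ *
      k⁻¹ * u⁻¹ * u⁻¹ * k⁻¹ * u * k * k) *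
      (u⁻¹ * k⁻¹ * k⁻¹ * u⁻¹ * k * u⁻¹)⁻¹ := by
      rw [hb, hh]
      simp only [mul_assoc, mul_inv_rev, inv_inv, mul_inv_cancel_left, inv_mul_cancel_left, mul_inv_cancel, inv_mul_cancel, mul_one, one_mul]
    rw [hR] at this
    rw [← mul_inv_eq_one, this]; simp

theorem conv_a (ξ κ z U K w : ℝ) (hξ : ξ ≠ 0) (hκ : κ ≠ 0) (hU : U = ξ ^ 2) (hK : K = κ ^ 2)
    (hw : w = ξ * κ * z) :
    (2 - 1 * κ ^ 2 * z ^ 2 + 4 * ξ * κ * z - 1 * ξ * κ ^ 3 * z - 4 * ξ ^ 2 + 1 * ξ ^ 2 * κ ^ 2 + 1 * ξ ^ 2 * κ ^ 2 * z ^ 2 - 2 * ξ ^ 3 * κ * z + 1 * ξ ^ 4) =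
      2 - 1 * w ^ 2 / U + 4 * w - 1 * w * K - 4 * U + 1 * U * K + 1 * w ^ 2 - 2 * w * U + 1 * U ^ 2 := by
  rw [hU, hK, hw]
  field_simp

theorem conv_b (ξ κ z U K w : ℝ) (hξ : ξ ≠ 0) (hκ : κ ≠ 0) (hU : U = ξ ^ 2) (hK : K = κ ^ 2)
    (hw : w = ξ * κ * z) :
    (2 - 4 * κ ^ 2 + 1 * κ ^ 4 + 4 * ξ * κ * z - 2 * ξ * κ ^ 3 * z - 1 * ξ ^ 2 * z ^ 2 + 1 * ξ ^ 2 * κ ^ 2 + 1 * ξ ^ 2 * κ ^ 2 * z ^ 2 - 1 * ξ ^ 3 * κ * z) =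
      2 - 4 * K + 1 * K ^ 2 + 4 * w - 2 * w * K - 1 * w ^ 2 / K + 1 * U * K + 1 * w ^ 2 - 1 * w * U := by
  rw [hU, hK, hw]
  field_simp

theorem conv_g (ξ κ z U K w : ℝ) (hξ : ξ ≠ 0) (hκ : κ ≠ 0) (hU : U = ξ ^ 2) (hK : K = κ ^ 2)
    (hw : w = ξ * κ * z) :
    ξ * (1 * κ * z + 3 * ξ - 1 * ξ * z ^ 2 - 1 * ξ * κ ^ 2 + 1 * ξ ^ 2 * κ * z - 1 * ξ ^ 3) =
      1 * w + 3 * U - 1 * w ^ 2 / K - 1 * U * K + 1 * w * U - 1 * U ^ 2 := by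
  rw [hU, hK, hw]
  field_simp

theorem conv_ag (ξ κ z U K w : ℝ) (hξ : ξ ≠ 0) (hκ : κ ≠ 0) (hU : U = ξ ^ 2) (hK : K = κ ^ 2)
    (hw : w = ξ * κ * z) :
    ξ * (- 1 * κ * z + 4 * κ ^ 3 * z - 1 * κ ^ 3 * z ^ 3 - 1 * κ ^ 5 * z + 7 * ξ - 1 * ξ * z ^ 2 - 14 * ξ * κ ^ 2 - 1 * ξ * κ ^ 2 * z ^ 2 + 1 * ξ * κ ^ 2 * z ^ 4 + 7 * ξ * κ ^ 4 + 1 * ξ * κ ^ 4 * z ^ 2 - 1 * ξ * κ ^ 6 + 18 * ξ ^ 2 * κ * z - 4 * ξ ^ 2 * κ * z ^ 3 - 16 * ξ ^ 2 * κ ^ 3 * z + 1 * ξ ^ 2 * κ ^ 3 * z ^ 3 + 3 * ξ ^ 2 * κ ^ 5 * z - 14 * ξ ^ 3 + 3 * ξ ^ 3 * z ^ 2 + 14 * ξ ^ 3 * κ ^ 2 + 7 * ξ ^ 3 * κ ^ 2 * z ^ 2 - 1 * ξ ^ 3 * κ ^ 2 * z ^ 4 - 3 * ξ ^ 3 * κ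 ^ 4 - 3 * ξ ^ 3 * κ ^ 4 * z ^ 2 - 15 * ξ ^ 4 * κ * z + 2 * ξ ^ 4 * κ * z ^ 3 + 6 * ξ ^ 4 * κ ^ 3 * z + 1 * ξ ^ 4 * κ ^ 3 * z ^ 3 + 7 * ξ ^ 5 - 1 * ξ ^ 5 * z ^ 2 - 3 * ξ ^ 5 * κ ^ 2 - 3 * ξ ^ 5 * κ ^ 2 * z ^ 2 + 3 * ξ ^ 6 * κ * z - 1 * ξ ^ 7) =
      -1 * w + 4 * w * K - 1 * w ^ 3 / U - 1 * w * K ^ 2 + 7 * U - 1 * w ^ 2 / K - 14 * U * K - 1 * w ^ 2 + 1 * w ^ 4 / U / K + 7 * U * K ^ 2 + 1 * w ^ 2 * K - 1 * U * K ^ 3 + 18 * w * U - 4 * w ^ 3 / K - 16 * w * U * K + 1 * w ^ 3 + 3 * w * U * K ^ 2 - 14 * U ^ 2 + 3 * w ^ 2 * U / K + 14 * U ^ 2 * K + 7 * w ^ 2 * U - 1 * w ^ 4 / K - 3 * U ^ 2 * K ^ 2 - 3 * w ^ 2 * U * K - 15 * w * U ^ 2 + 2 * w ^ 3 * U / K +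 6 * w * U ^ 2 * K + 1 * w ^ 3 * U + 7 * U ^ 3 - 1 * w ^ 2 * U ^ 2 / K - 3 * U ^ 3 * K - 3 * w ^ 2 * U ^ 2 + 3 * w * U ^ 3 - 1 * U ^ 4 := by
  rw [hU, hK, hw]
  field_simp

theorem conv_h (ξ κ z U K w : ℝ) (hξ : ξ ≠ 0) (hκ : κ ≠ 0) (hU : U = ξ ^ 2) (hK : K = κ ^ 2)
    (hw : w = ξ * κ * z) :
    κ * (3 * κ - 1 * κ * z ^ 2 - 1 * κ ^ 3 + 1 * ξ * z + 1 * ξ * κ ^ 2 * z - 1 * ξ ^ 2 * κ) =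
      3 * K - 1 * w ^ 2 / U - 1 * K ^ 2 + 1 * w + 1 * w * K - 1 * U * K := by
  rw [hU, hK, hw]
  field_simp

theorem conv_bh (ξ κ z U K w : ℝ) (hξ : ξ ≠ 0) (hκ : κ ≠ 0) (hU : U = ξ ^ 2) (hK : K = κ ^ 2)
    (hw : w = ξ * κ * z) :
    κ * (7 * κ - 1 * κ * z ^ 2 - 14 * κ ^ 3 + 3 * κ ^ 3 * z ^ 2 + 7 * κ ^ 5 - 1 * κ ^ 5 * z ^ 2 - 1 * κ ^ 7 - 1 * ξ * z + 18 * ξ * κ ^ 2 * z - 4 * ξ * κ ^ 2 * z ^ 3 - 15 * ξ * κ ^ 4 * z + 2 * ξ * κ ^ 4 * z ^ 3 + 3 * ξ * κ ^ 6 * z - 14 * ξ ^ 2 * κ - 1 * ξ ^ 2 * κ * z ^ 2 + 1 * ξ ^ 2 * κ * z ^ 4 + 14 * ξ ^ 2 * κ ^ 3 + 7 * ξ ^ 2 * κ ^ 3 * z ^ 2 - 1 * ξ ^ 2 * κ ^ 3 * z ^ 4 - 3 * ξ ^ 2 * κ ^ 5 - 3 * ξ ^ 2 * κ ^ 5 *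 z ^ 2 + 4 * ξ ^ 3 * z - 1 * ξ ^ 3 * z ^ 3 - 16 * ξ ^ 3 * κ ^ 2 * z + 1 * ξ ^ 3 * κ ^ 2 * z ^ 3 + 6 * ξ ^ 3 * κ ^ 4 * z + 1 * ξ ^ 3 * κ ^ 4 * z ^ 3 + 7 * ξ ^ 4 * κ + 1 * ξ ^ 4 * κ * z ^ 2 - 3 * ξ ^ 4 * κ ^ 3 - 3 * ξ ^ 4 * κ ^ 3 * z ^ 2 - 1 * ξ ^ 5 * z + 3 * ξ ^ 5 * κ ^ 2 * z - 1 * ξ ^ 6 * κ) =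
      7 * K - 1 * w ^ 2 / U - 14 * K ^ 2 + 3 * w ^ 2 * K / U + 7 * K ^ 3 - 1 * w ^ 2 * K ^ 2 / U - 1 * K ^ 4 - 1 * w + 18 * w * K - 4 * w ^ 3 / U - 15 * w * K ^ 2 + 2 * w ^ 3 * K / U + 3 * w * K ^ 3 - 14 * U * K - 1 * w ^ 2 + 1 * w ^ 4 / U / K + 14 * U * K ^ 2 + 7 * w ^ 2 * K - 1 * w ^ 4 / U - 3 * U * K ^ 3 - 3 * w ^ 2 * K ^ 2 + 4 * w * U - 1 * w ^ 3 / K - 16 * w * U * K + 1 * w ^ 3 + 6 * w * U * K ^ 2 + 1 * w ^ 3 * K + 7 * U ^ 2 * K + 1 * w ^ 2 * U - 3 * U ^ 2 * K ^ 2 - 3 * w ^ 2 * U * K - 1 * w * U ^ 2 + 3 * w * U ^ 2 * K - 1 * U ^ 3 * K := by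
  rw [hU, hK, hw]
  field_simp

set_option maxHeartbeats 4000000 in
theorem par_a (τ l t N D₁ D₂ : ℝ) (hτ : τ ≠ 0) (hl : l ≠ 0) (hN : N ≠ 0) (hD₁ : D₁ ≠ 0) (hD₂ : D₂ ≠ 0)
    (ht : t = 2 + τ) (hNe : N = (t - 1) ^ 2 + τ * (t ^ 2 - 3 * t + 1) * l - (t - 1) * τ ^ 2 * l ^ 2)
    (hD₁e : D₁ = t - τ * l) (hD₂e : D₂ = t - 1 + t * τ * l) (U K w : ℝ)
    (hU : U = τ ^ 2 * D₁ * l / N) (hK : K = τ * D₂ / N) (hw : w = τ * D₁ * D₂ / N) :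
    2 - 1 * w ^ 2 / U + 4 * w - 1 * w * K - 4 * U + 1 * U * K + 1 * w ^ 2 - 2 * w * U + 1 * U ^ 2 =
      2 - D₁ * ((t - 1) ^ 2 + (t - 1) * τ ^ 2 * l - τ ^ 3 * l ^ 2) / (l * N) := by
  rw [hU, hK, hw]
  field_simp
  rw [hNe, hD₁e, hD₂e, ht]
  ring

set_option maxHeartbeats 4000000 in
theorem par_b (τ l t N D₁ D₂ : ℝ) (hτ : τ ≠ 0) (hl : l ≠ 0) (hN : N ≠ 0) (hD₁ : D₁ ≠ 0) (hD₂ : D₂ ≠ 0)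
    (ht : t = 2 + τ) (hNe : N = (t - 1) ^ 2 + τ * (t ^ 2 - 3 * t + 1) * l - (t - 1) * τ ^ 2 * l ^ 2)
    (hD₁e : D₁ = t - τ * l) (hD₂e : D₂ = t - 1 + t * τ * l) (U K w : ℝ)
    (hU : U = τ ^ 2 * D₁ * l / N) (hK : K = τ * D₂ / N) (hw : w = τ * D₁ * D₂ / N) :
    2 - 4 * K + 1 * K ^ 2 + 4 * w - 2 * w * K - 1 * w ^ 2 / K + 1 * U * K + 1 * w ^ 2 - 1 * w * U =
      2 + τ ^ 2 * D₂ * (1 + τ * l * (1 - l)) / N := by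
  rw [hU, hK, hw]
  field_simp
  rw [hNe, hD₁e, hD₂e, ht]
  ring

set_option maxHeartbeats 4000000 in
theorem par_gp (τ l t N D₁ D₂ : ℝ) (hτ : τ ≠ 0) (hl : l ≠ 0) (hN : N ≠ 0) (hD₁ : D₁ ≠ 0) (hD₂ : D₂ ≠ 0)
    (ht : t = 2 + τ) (hNe : N = (t - 1) ^ 2 + τ * (t ^ 2 - 3 * t + 1) * l - (t - 1) * τ ^ 2 * l ^ 2)
    (hD₁e : D₁ = t - τ * l) (hD₂e : D₂ = t - 1 + t * τ * l) (U K w : ℝ)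
    (hU : U = τ ^ 2 * D₁ * l / N) (hK : K = τ * D₂ / N) (hw : w = τ * D₁ * D₂ / N) :
    (1 * w + 3 * U - 1 * w ^ 2 / K - 1 * U * K + 1 * w * U - 1 * U ^ 2) + (-1 * w + 4 * w * K - 1 * w ^ 3 / U - 1 * w * K ^ 2 + 7 * U - 1 * w ^ 2 / K - 14 * U * K - 1 * w ^ 2 + 1 * w ^ 4 / U / K + 7 * U * K ^ 2 + 1 * w ^ 2 * K - 1 * U * K ^ 3 + 18 * w * U - 4 * w ^ 3 / K - 16 * w * U * K + 1 * w ^ 3 + 3 * w * U * K ^ 2 - 14 * U ^ 2 + 3 * w ^ 2 * U / K + 14 * U ^ 2 * K + 7 * w ^ 2 * U - 1 * w ^ 4 / K - 3 * U ^ 2 * K ^ 2 - 3 * w ^ 2 * U * K - 15 * w * U ^ 2 + 2 * w ^ 3 * U / K + 6 * w * U ^ 2 * K + 1 * w ^ 3 * U + 7 * U ^ 3 - 1 * w ^ 2 * U ^ 2 / K - 3 * U ^ 3 * K - 3 * w ^ 2 * U ^ 2 + 3 * w * U ^ 3 - 1 * U ^ 4) =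
      -τ * D₁ * (-t ^ 2 * τ ^ 2 * l ^ 3 + t ^ 2 * (2 * t - 5) * τ * l ^ 2 - (t - 1) * (t ^ 3 - 5 * t ^ 2 + 3 * t + 2) * l - t * (t - 1) ^ 2) / (l * N) := by
  rw [hU, hK, hw]
  field_simp
  rw [hNe, hD₁e, hD₂e, ht]
  ring

set_option maxHeartbeats 4000000 in
theorem par_gm (τ l t N D₁ D₂ : ℝ) (hτ : τ ≠ 0) (hl : l ≠ 0) (hN : N ≠ 0) (hD₁ : D₁ ≠ 0) (hD₂ : D₂ ≠ 0)
    (ht : t = 2 + τ) (hNe : N = (t - 1) ^ 2 + τ * (t ^ 2 - 3 * t + 1) * l - (t - 1) * τ ^ 2 * l ^ 2)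
    (hD₁e : D₁ = t - τ * l) (hD₂e : D₂ = t - 1 + t * τ * l) (U K w : ℝ)
    (hU : U = τ ^ 2 * D₁ * l / N) (hK : K = τ * D₂ / N) (hw : w = τ * D₁ * D₂ / N) :
    (1 * w + 3 * U - 1 * w ^ 2 / K - 1 * U * K + 1 * w * U - 1 * U ^ 2) - (-1 * w + 4 * w * K - 1 * w ^ 3 / U - 1 * w * K ^ 2 + 7 * U - 1 * w ^ 2 / K - 14 * U * K - 1 * w ^ 2 + 1 * w ^ 4 / U / K + 7 * U * K ^ 2 + 1 * w ^ 2 * K - 1 * U * K ^ 3 + 18 * w * U - 4 * w ^ 3 / K - 16 * w * U * K + 1 * w ^ 3 + 3 * w * U * K ^ 2 - 14 * U ^ 2 + 3 * w ^ 2 * U / K + 14 * U ^ 2 * K + 7 * w ^ 2 * U - 1 * w ^ 4 / K - 3 * U ^ 2 * K ^ 2 - 3 * w ^ 2 * U * K - 15 * w * U ^ 2 + 2 * w ^ 3 * U / K + 6 * w * U ^ 2 * K + 1 * w ^ 3 * U + 7 * U ^ 3 - 1 * w ^ 2 * U ^ 2 / K - 3 * U ^ 3 * K - 3 * w ^ 2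 * U ^ 2 + 3 * w * U ^ 3 - 1 * U ^ 4) =
      -τ * t * D₁ * ((t - 1) ^ 2 + (t - 1) * τ ^ 2 * l - τ ^ 3 * l ^ 2) * (1 - l) / (l * N) := by
  rw [hU, hK, hw]
  field_simp
  rw [hNe, hD₁e, hD₂e, ht]
  ring

set_option maxHeartbeats 4000000 in
theorem par_hp (τ l t N D₁ D₂ : ℝ) (hτ : τ ≠ 0) (hl : l ≠ 0) (hN : N ≠ 0) (hD₁ : D₁ ≠ 0) (hD₂ : D₂ ≠ 0)
    (ht : t = 2 + τ) (hNe : N = (t - 1) ^ 2 + τ * (t ^ 2 - 3 * t + 1) * l - (t - 1) * τ ^ 2 * l ^ 2)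
    (hD₁e : D₁ = t - τ * l) (hD₂e : D₂ = t - 1 + t * τ * l) (U K w : ℝ)
    (hU : U = τ ^ 2 * D₁ * l / N) (hK : K = τ * D₂ / N) (hw : w = τ * D₁ * D₂ / N) :
    (7 * K - 1 * w ^ 2 / U - 14 * K ^ 2 + 3 * w ^ 2 * K / U + 7 * K ^ 3 - 1 * w ^ 2 * K ^ 2 / U - 1 * K ^ 4 - 1 * w + 18 * w * K - 4 * w ^ 3 / U - 15 * w * K ^ 2 + 2 * w ^ 3 * K / U + 3 * w * K ^ 3 - 14 * U * K - 1 * w ^ 2 + 1 * w ^ 4 / U / K + 14 * U * K ^ 2 + 7 * w ^ 2 * K - 1 * w ^ 4 / U - 3 * U * K ^ 3 - 3 * w ^ 2 * K ^ 2 + 4 * w * U - 1 * w ^ 3 / K - 16 * w * U * K + 1 * w ^ 3 + 6 * w * U * K ^ 2 + 1 * w ^ 3 * K + 7 * U ^ 2 * K + 1 * w ^ 2 * U - 3 * U ^ 2 * K ^ 2 - 3 * w ^ 2 * U * K - 1 * w * U ^ 2 + 3 * w * U ^ 2 * K - 1 * U ^ 3 * K) + (3 * K - 1 * w ^ 2 /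 U - 1 * K ^ 2 + 1 * w + 1 * w * K - 1 * U * K) =
      -D₂ * (t ^ 2 * (t - 1) + t ^ 2 * (2 * t - 5) * τ * l + (t ^ 3 - 5 * t ^ 2 + 3 * t + 2) * τ ^ 2 * l ^ 2 - t * τ ^ 4 * l ^ 3) / (l * N) := by
  rw [hU, hK, hw]
  field_simp
  rw [hNe, hD₁e, hD₂e, ht]
  ring

set_option maxHeartbeats 4000000 in
theorem par_hm (τ l t N D₁ D₂ : ℝ) (hτ : τ ≠ 0) (hl : l ≠ 0) (hN : N ≠ 0) (hD₁ : D₁ ≠ 0) (hD₂ : D₂ ≠ 0)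
    (ht : t = 2 + τ) (hNe : N = (t - 1) ^ 2 + τ * (t ^ 2 - 3 * t + 1) * l - (t - 1) * τ ^ 2 * l ^ 2)
    (hD₁e : D₁ = t - τ * l) (hD₂e : D₂ = t - 1 + t * τ * l) (U K w : ℝ)
    (hU : U = τ ^ 2 * D₁ * l / N) (hK : K = τ * D₂ / N) (hw : w = τ * D₁ * D₂ / N) :
    (7 * K - 1 * w ^ 2 / U - 14 * K ^ 2 + 3 * w ^ 2 * K / U + 7 * K ^ 3 - 1 * w ^ 2 * K ^ 2 / U - 1 * K ^ 4 - 1 * w + 18 * w * K - 4 * w ^ 3 / U - 15 * w * K ^ 2 + 2 * w ^ 3 * K / U + 3 * w * K ^ 3 - 14 * U * K - 1 * w ^ 2 + 1 * w ^ 4 / U / K + 14 * U * K ^ 2 + 7 * w ^ 2 * K - 1 * w ^ 4 / U - 3 * U * K ^ 3 - 3 * w ^ 2 * K ^ 2 + 4 * w * U - 1 * w ^ 3 / K - 16 * w * U * K + 1 * w ^ 3 + 6 * w * U * K ^ 2 + 1 * w ^ 3 * K + 7 * U ^ 2 * K + 1 * w ^ 2 * U - 3 * U ^ 2 * K ^ 2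 - 3 * w ^ 2 * U * K - 1 * w * U ^ 2 + 3 * w * U ^ 2 * K - 1 * U ^ 3 * K) - (3 * K - 1 * w ^ 2 / U - 1 * K ^ 2 + 1 * w + 1 * w * K - 1 * U * K) =
      -t * (1 + τ * l * (1 - l)) * (t - 1 + τ ^ 2 * l) * τ * D₂ / (l * N) := by
  rw [hU, hK, hw]
  field_simp
  rw [hNe, hD₁e, hD₂e, ht]
  ring

set_option maxHeartbeats 4000000 in
theorem par_f (τ l t N D₁ D₂ : ℝ) (hτ : τ ≠ 0) (hl : l ≠ 0) (hN : N ≠ 0) (hD₁ : D₁ ≠ 0) (hD₂ : D₂ ≠ 0)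
    (ht : t = 2 + τ) (hNe : N = (t - 1) ^ 2 + τ * (t ^ 2 - 3 * t + 1) * l - (t - 1) * τ ^ 2 * l ^ 2)
    (hD₁e : D₁ = t - τ * l) (hD₂e : D₂ = t - 1 + t * τ * l) (U K w : ℝ)
    (hU : U = τ ^ 2 * D₁ * l / N) (hK : K = τ * D₂ / N) (hw : w = τ * D₁ * D₂ / N) :
    w ^ 2 * (1 - (U + K) + U * K) + ((U + K) ^ 2 - 2 * (U + K) + 5 * (U * K) - 2 * (U * K) * (U + K)) * w + U * K * ((U + K) ^ 2 - 5 * (U + K) + 5) =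
      0 := by
  rw [hU, hK, hw]
  field_simp
  rw [hNe, hD₁e, hD₂e, ht]
  ring

set_option maxHeartbeats 2000000 in
theorem core (m n : ℕ) (τ l t N D₁ D₂ C₁ ea eb θ B : ℝ) (hτ : 0 < τ) (hl : 0 < l) (ht : t = 2 + τ)
    (hNe : N = (t - 1) ^ 2 + τ * (t ^ 2 - 3 * t + 1) * l - (t - 1) * τ ^ 2 * l ^ 2)
    (hD₁e : D₁ = t - τ * l) (hD₂e : D₂ = t - 1 + t * τ * l)
    (hC₁e : C₁ = (-t ^ 2 * τ ^ 2 * l ^ 3 + t ^ 2 * (2 * t - 5) * τ * l ^ 2 - (t - 1) * (t ^ 3 - 5 * t ^ 2 + 3 * t + 2) * l - t * (t - 1) ^ 2))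
    (heae : ea = ((t - 1) ^ 2 + (t - 1) * τ ^ 2 * l - τ ^ 3 * l ^ 2)) (hebe : eb = (1 + τ * l * (1 - l)))
    (hN : 0 < N) (hD₁ : 0 < D₁) (hD₂ : 0 < D₂) (hC₁ : 0 < C₁) (hea : 0 < ea) (heb : 0 < eb)
    (hz4 : 4 * τ * l ≤ D₁ * D₂)
    (hs : Real.sin θ = √(C₁ / (4 * l * N))) (hc : Real.cos θ = √(D₁ * ea / (4 * l * N)))
    (hqs : Real.sin ((2 * m + 1) * θ) = -(√(D₁ * C₁) / (2 * l)))
    (hqc : Real.cos ((2 * m + 1) * θ) = -(t * √ea * (1 - l) / (2 * l)))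
    (hB : Real.sinh B = τ / 2 * √(D₂ * eb / N))
    (hpB : Real.sinh ((2 * n + 1) * B) = t * √eb * (t - 1 + τ ^ 2 * l) / (2 * √τ * l)) :
    Infinite (PresentedGroup (pretzelRels (2 * n + 1) (2 * m + 1)
      (2 * ((2 * n + 1) + (2 * m + 1)) - 1))) := by
  obtain ⟨cb, hcbe⟩ : ∃ cb, cb = (t ^ 2 * (t - 1) + t ^ 2 * (2 * t - 5) * τ * l + (t ^ 3 - 5 * t ^ 2 + 3 * t + 2) * τ ^ 2 * l ^ 2 - t * τ ^ 4 * l ^ 3) := ⟨_, rfl⟩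
  have idb1 : 4 * N + τ ^ 2 * D₂ * eb = cb := by rw [hNe, hD₂e, hebe, hcbe, ht]; ring
  have idb2 : 4 * τ * l ^ 2 + t ^ 2 * eb * (t - 1 + τ ^ 2 * l) ^ 2 = D₂ * cb := by
    rw [hD₂e, hebe, hcbe, ht]; ring
  have hcb : 0 < cb := by rw [← idb1]; positivity
  obtain ⟨ε, hε⟩ : ∃ ε : ℝ, ε = (-1) ^ m := ⟨_, rfl⟩
  have hε2 : ε ^ 2 = 1 := by rw [hε, ← pow_mul, mul_comm, pow_mul]; simp
  have hε0 : ε ≠ 0 := by intro h; rw [h] at hε2; norm_num at hε2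
  obtain ⟨rN, hrN⟩ : ∃ r, r = √N := ⟨_, rfl⟩
  obtain ⟨rτ, hrτ⟩ : ∃ r, r = √τ := ⟨_, rfl⟩
  obtain ⟨rl, hrl⟩ : ∃ r, r = √l := ⟨_, rfl⟩
  obtain ⟨rD₁, hrD₁⟩ : ∃ r, r = √D₁ := ⟨_, rfl⟩
  obtain ⟨rD₂, hrD₂⟩ : ∃ r, r = √D₂ := ⟨_, rfl⟩
  obtain ⟨rC, hrC⟩ : ∃ r, r = √C₁ := ⟨_, rfl⟩
  obtain ⟨ra, hra⟩ : ∃ r, r = √ea := ⟨_, rfl⟩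
  obtain ⟨rb, hrb⟩ : ∃ r, r = √eb := ⟨_, rfl⟩
  have pN : 0 < rN := by rw [hrN]; exact Real.sqrt_pos.2 hN
  have pτ : 0 < rτ := by rw [hrτ]; exact Real.sqrt_pos.2 hτ
  have pl : 0 < rl := by rw [hrl]; exact Real.sqrt_pos.2 hl
  have pD₁ : 0 < rD₁ := by rw [hrD₁]; exact Real.sqrt_pos.2 hD₁
  have pD₂ : 0 < rD₂ := by rw [hrD₂]; exact Real.sqrt_pos.2 hD₂
  have pC : 0 < rC := by rw [hrC]; exact Real.sqrt_pos.2 hC₁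
  have pa : 0 < ra := by rw [hra]; exact Real.sqrt_pos.2 hea
  have pb : 0 < rb := by rw [hrb]; exact Real.sqrt_pos.2 heb
  have qN : N = rN ^ 2 := by rw [hrN, Real.sq_sqrt hN.le]
  have qτ : τ = rτ ^ 2 := by rw [hrτ, Real.sq_sqrt hτ.le]
  have ql : l = rl ^ 2 := by rw [hrl, Real.sq_sqrt hl.le]
  have qD₁ : D₁ = rD₁ ^ 2 := by rw [hrD₁, Real.sq_sqrt hD₁.le]
  have qD₂ : D₂ = rD₂ ^ 2 := by rw [hrD₂, Real.sq_sqrt hD₂.le]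
  have qC : C₁ = rC ^ 2 := by rw [hrC, Real.sq_sqrt hC₁.le]
  have qa : ea = ra ^ 2 := by rw [hra, Real.sq_sqrt hea.le]
  have qb : eb = rb ^ 2 := by rw [hrb, Real.sq_sqrt heb.le]
  have hs' : Real.sin θ = rC / (2 * rl * rN) := by
    rw [hs, show C₁ / (4 * l * N) = (rC / (2 * rl * rN)) ^ 2 by rw [qC, ql, qN]; field_simp; ring]
    exact Real.sqrt_sq (by positivity)
  have hc' : Real.cos θ = rD₁ * ra / (2 * rl * rN) := by
    rw [hc, show D₁ * ea / (4 * l * N) = (rD₁ * ra / (2 * rl * rN)) ^ 2 by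
      rw [qD₁, qa, ql, qN]; field_simp; ring]
    exact Real.sqrt_sq (by positivity)
  have hqs' : Real.sin ((2 * m + 1) * θ) = -(rD₁ * rC / (2 * l)) := by
    rw [hqs, Real.sqrt_mul hD₁.le, ← hrD₁, ← hrC]
  have hB' : Real.sinh B = τ * rD₂ * rb / (2 * rN) := by
    rw [hB, show D₂ * eb / N = (rD₂ * rb / rN) ^ 2 by rw [qD₂, qb, qN]; field_simp]
    rw [Real.sqrt_sq (by positivity)]
    field_simp
  have hcosh : 4 * (Real.cosh ((2 * n + 1) * B) * Real.cosh B) = rD₂ * cb / (rτ * l * rN) := by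
    have h1 : Real.cosh B ^ 2 = cb / (4 * N) := by
      rw [Real.cosh_sq, hB', ← idb1, qD₂, qb, qN]; field_simp; ring
    have h2 : Real.cosh ((2 * n + 1) * B) ^ 2 = D₂ * cb / (4 * τ * l ^ 2) := by
      rw [Real.cosh_sq, hpB, ← idb2, ← hrτ, ← hrb, qb, qτ]; field_simp; ring
    have h3 : (4 * (Real.cosh ((2 * n + 1) * B) * Real.cosh B)) ^ 2 =
        (rD₂ * cb / (rτ * l * rN)) ^ 2 := by
      rw [mul_pow, mul_pow, h1, h2, qN, qτ, qD₂]; field_simp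
    have := Real.cosh_pos B
    have := Real.cosh_pos ((2 * n + 1) * B)
    exact (pow_left_inj₀ (by positivity) (by positivity) two_ne_zero).1 h3
  obtain ⟨ξ, hξ⟩ : ∃ ξ, ξ = ε * (τ * rD₁ * rl / rN) := ⟨_, rfl⟩
  obtain ⟨κ, hκ⟩ : ∃ κ, κ = -(rτ * rD₂ / rN) := ⟨_, rfl⟩
  have hξ0 : ξ ≠ 0 := by rw [hξ]; exact mul_ne_zero hε0 (by positivity)
  have hκ0 : κ ≠ 0 := by rw [hκ]; exact neg_ne_zero.2 (by positivity)
  obtain ⟨U, hU⟩ : ∃ U, U = ξ ^ 2 := ⟨_, rfl⟩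
  obtain ⟨K, hK⟩ : ∃ K, K = κ ^ 2 := ⟨_, rfl⟩
  have hU' : U = τ ^ 2 * D₁ * l / N := by
    rw [hU, hξ, mul_pow, hε2, qD₁, ql, qN]; field_simp
  have hK' : K = τ * D₂ / N := by
    rw [hK, hκ, qτ, qD₂, qN]; field_simp
  obtain ⟨w, hw'⟩ : ∃ w, w = τ * D₁ * D₂ / N := ⟨_, rfl⟩
  obtain ⟨z, hz⟩ : ∃ z, z = w / (ξ * κ) := ⟨_, rfl⟩
  have hw : w = ξ * κ * z := by rw [hz]; field_simp
  have hz2 : z ^ 2 = D₁ * D₂ / (τ * l) := by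
    rw [hz, div_pow, mul_pow, ← hU, ← hK, hU', hK', hw']; field_simp
  obtain ⟨ζ, hζ, hzζ⟩ := exists_zeta z (by rw [hz2, le_div_iff₀ (by positivity)]; linarith)
  have hf := par_f τ l t N D₁ D₂ hτ.ne' hl.ne' hN.ne' hD₁.ne' hD₂.ne' ht hNe hD₁e hD₂e U K w hU' hK' hw'
  have pra := par_a τ l t N D₁ D₂ hτ.ne' hl.ne' hN.ne' hD₁.ne' hD₂.ne' ht hNe hD₁e hD₂e U K w hU' hK' hw'
  have prb := par_b τ l t N D₁ D₂ hτ.ne' hl.ne' hN.ne' hD₁.ne' hD₂.ne' ht hNe hD₁e hD₂e U K w hU' hK' hw'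
  have gp := par_gp τ l t N D₁ D₂ hτ.ne' hl.ne' hN.ne' hD₁.ne' hD₂.ne' ht hNe hD₁e hD₂e U K w hU' hK' hw'
  have gm := par_gm τ l t N D₁ D₂ hτ.ne' hl.ne' hN.ne' hD₁.ne' hD₂.ne' ht hNe hD₁e hD₂e U K w hU' hK' hw'
  have hp := par_hp τ l t N D₁ D₂ hτ.ne' hl.ne' hN.ne' hD₁.ne' hD₂.ne' ht hNe hD₁e hD₂e U K w hU' hK' hw'
  have hm := par_hm τ l t N D₁ D₂ hτ.ne' hl.ne' hN.ne' hD₁.ne' hD₂.ne' ht hNe hD₁e hD₂e U K w hU' hK' hw'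
  rw [← conv_a ξ κ z U K w hξ0 hκ0 hU hK hw, ← heae, ← tr_a ξ κ ζ z hζ hzζ] at pra
  rw [← conv_b ξ κ z U K w hξ0 hκ0 hU hK hw, ← hebe, ← tr_b ξ κ ζ z hζ hzζ] at prb
  rw [← conv_g ξ κ z U K w hξ0 hκ0 hU hK hw, ← conv_ag ξ κ z U K w hξ0 hκ0 hU hK hw,
    ← tr_g ξ κ ζ z hζ hzζ, ← tr_ag ξ κ ζ z hζ hzζ] at gp gm
  rw [← conv_h ξ κ z U K w hξ0 hκ0 hU hK hw, ← conv_bh ξ κ z U K w hξ0 hκ0 hU hK hw,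
    ← tr_h ξ κ ζ z hζ hzζ, ← tr_bh ξ κ ζ z hζ hzζ] at hp hm
  rw [← hC₁e] at gp
  rw [← heae] at gm
  rw [← hcbe] at hp
  rw [← hebe] at hm
  have hR := rel_of_star _ _ (star_of_f ξ κ ζ z hζ hzζ (by
    apply (mul_eq_zero.1 (?_ : (ξ * κ) * _ = 0)).resolve_left (mul_ne_zero hξ0 hκ0)
    rw [← hf, hU, hK, hw]; ring))
  generalize hu : mu ξ = u at *
  generalize hk : mk κ ζ hζ = k at *
  obtain ⟨a, ha⟩ : ∃ a, a = u * u * k * k * u * k * k * u := ⟨_, rfl⟩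
  obtain ⟨b, hb⟩ : ∃ b, b = u⁻¹ * k⁻¹ * k⁻¹ * u⁻¹ * k * u * u * k * k * k * u * u * u * k * k * u :=
    ⟨_, rfl⟩
  obtain ⟨g, hg⟩ : ∃ g, g = u⁻¹ * k⁻¹ * k⁻¹ * k⁻¹ * u⁻¹ * u⁻¹ * k⁻¹ * u * k * k * u := ⟨_, rfl⟩
  obtain ⟨h, hh⟩ : ∃ h, h = u⁻¹ * k⁻¹ * k⁻¹ * u⁻¹ * k := ⟨_, rfl⟩
  have eag : u * u * k * k * u * k⁻¹ * u⁻¹ * u⁻¹ * k⁻¹ * u * k * k * u = a * g := by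
    rw [ha, hg]; simp only [mul_assoc, mul_inv_cancel_left]
  have ebh : u⁻¹ * k⁻¹ * k⁻¹ * u⁻¹ * k * u * u * k * k * k * u * u * k = b * h := by
    rw [hb, hh]; simp only [mul_assoc, mul_inv_cancel_left]
  rw [← ha] at pra
  rw [← hb] at prb
  rw [← hg, eag] at gp gm
  rw [ebh, ← hh] at hp hm
  obtain ⟨cag, cbh⟩ := comm_of_rel u k a b g h ha hb hg hh hR
  -- the elliptic side
  have hφ : a.1.trace = 2 * Real.cos (Real.pi - 2 * θ) := by
    rw [pra, Real.cos_pi_sub, Real.cos_two_mul, hc', qD₁, qa, ql, qN]; field_simp; ring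
  have hpa := trace_pow_cos a.1 a.2 _ hφ
  have sumg : g.1.trace + (a * g).1.trace = 4 * ε * (Real.sin ((2 * m + 1) * θ) * Real.sin θ) := by
    apply mul_left_cancel₀ hξ0
    rw [mul_add, gp, hqs', hs', hξ]
    rw [qC, qD₁, ql, qN]
    field_simp
    linear_combination (4 : ℝ) * hε2
  have difg : g.1.trace - (a * g).1.trace = 4 * ε * (Real.cos ((2 * m + 1) * θ) * Real.cos θ) := by
    apply mul_left_cancel₀ hξ0
    rw [mul_sub, gm, hqc, hc', hξ, ← hra]
    rw [qa, qD₁, ql, qN]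
    field_simp
    linear_combination (4 * t * (1 - rl ^ 2) : ℝ) * hε2
  have hgm : a ^ m = g := by
    apply eq_pow_of_trace a g m _ cag
    · rw [hpa m, show (m : ℝ) * (Real.pi - 2 * θ) = m * Real.pi - ((2 * m + 1) * θ - θ) by ring,
        Real.cos_nat_mul_pi_sub, ← hε, Real.cos_sub]
      linear_combination (sumg + difg) / 2
    · rw [hpa (m + 1), show ((m + 1 : ℕ) : ℝ) * (Real.pi - 2 * θ) =
        (m + 1 : ℕ) * Real.pi - ((2 * m + 1) * θ + θ) by push_cast; ring,
        Real.cos_nat_mul_pi_sub, pow_succ, ← hε, Real.cos_add]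
      linear_combination (sumg - difg) / 2
    · rw [hφ, Real.cos_pi_sub, Real.cos_two_mul]
      have h1 : 0 < Real.sin θ := by rw [hs']; positivity
      have h2 : 0 < Real.cos θ := by rw [hc']; positivity
      have h3 := Real.sin_sq_add_cos_sq θ
      intro h4
      have : Real.sin θ ^ 2 * Real.cos θ ^ 2 = 0 := by
        rw [show Real.sin θ ^ 2 = 1 - Real.cos θ ^ 2 by linarith]
        linear_combination -h4 / 16
      have : 0 < Real.sin θ ^ 2 * Real.cos θ ^ 2 := by positivity
      linarith
  -- the hyperbolic side
  have hφb : b.1.trace = 2 * Real.cosh (2 * B) := by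
    rw [prb, Real.cosh_two_mul, Real.cosh_sq, hB', qD₂, qb, qN]; field_simp; ring
  have hpb := trace_pow_cosh b.1 b.2 _ hφb
  have htr : 2 < b.1.trace := by
    rw [prb]; have : 0 < τ ^ 2 * D₂ * eb / N := by positivity
    linarith
  have sumh : (b * h).1.trace + h.1.trace = 4 * (Real.cosh ((2 * n + 1) * B) * Real.cosh B) := by
    apply mul_left_cancel₀ hκ0
    rw [mul_add, hp, hcosh, hκ, qD₂, qN]
    field_simp
  have difh : (b * h).1.trace - h.1.trace = 4 * (Real.sinh ((2 * n + 1) * B) * Real.sinh B) := by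
    apply mul_left_cancel₀ hκ0
    rw [mul_sub, hm, hpB, hB', hκ, ← hrτ, ← hrb, qD₂, qN, qb]
    field_simp
    ring
  have hb4 : b.1.trace ^ 2 ≠ 4 := by
    apply ne_of_gt
    have := pow_lt_pow_left₀ htr (by norm_num) two_ne_zero
    norm_num at this
    exact this
  have hhn : b ^ n = h := by
    apply eq_pow_of_trace b h n hb4 cbh
    · rw [hpb n, show (n : ℝ) * (2 * B) = (2 * n + 1) * B - B by ring, Real.cosh_sub]
      linear_combination (sumh - difh) / 2
    · rw [hpb (n + 1), show ((n + 1 : ℕ) : ℝ) * (2 * B) = (2 * n + 1) * B + B by push_cast; ring,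
        Real.cosh_add]
      linear_combination (sumh + difh) / 2
  exact pretzel_infinite_of_rep m n u k a b g h ha hb hg hh hR (Or.inl hgm) hhn htr

theorem stay_lt (h : ℝ → ℝ) (hc : Continuous h) (a b c : ℝ) (hne : ∀ t ∈ Set.uIcc a b, h t ≠ c)
    (h0 : h a < c) : h b < c := by
  by_contra hb
  push Not at hb
  obtain ⟨t, ht, he⟩ := intermediate_value_uIcc (f := h) (a := a) (b := b) hc.continuousOn
    (Set.mem_uIcc.2 (Or.inl ⟨h0.le, hb⟩))
  exact hne t ht he

theorem stay_gt (h : ℝ → ℝ) (hc : Continuous h) (a b c : ℝ) (hne : ∀ t ∈ Set.uIcc a b, h t ≠ c)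
    (h0 : c < h a) : c < h b := by
  by_contra hb
  push Not at hb
  obtain ⟨t, ht, he⟩ := intermediate_value_uIcc (f := h) (a := a) (b := b) hc.continuousOn
    (Set.mem_uIcc.2 (Or.inr ⟨hb, h0.le⟩))
  exact hne t ht he

/-- The two-dimensional Poincare-Miranda theorem. -/
theorem poincare_miranda_aux (f g : ℝ × ℝ → ℝ) (hf : Continuous f) (hg : Continuous g)
    (hl : ∀ y ∈ Set.Icc (0 : ℝ) 1, f (0, y) < 0) (hr : ∀ y ∈ Set.Icc (0 : ℝ) 1, 0 < f (1, y))
    (hb : ∀ x ∈ Set.Icc (0 : ℝ) 1, g (x, 0) < 0) (ht : ∀ x ∈ Set.Icc (0 : ℝ) 1, 0 < g (x, 1)) :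
    ∃ v, f v = 0 ∧ g v = 0 := by
  by_contra hno
  push Not at hno
  let F : C(ℝ × ℝ, ℂ) := ⟨fun v => (f v : ℂ) + g v * Complex.I, by fun_prop⟩
  have hFre : ∀ v, (F v).re = f v := by intro v; simp [F]
  have hFim : ∀ v, (F v).im = g v := by intro v; simp [F]
  have hF0 : ∀ v, F v ≠ 0 := by
    intro v h
    apply hno v
    · rw [← hFre, h]; simp
    · rw [← hFim, h]; simp
  have m0 : (0 : ℝ) ∈ Set.Icc (0 : ℝ) 1 := by simp
  have m1 : (1 : ℝ) ∈ Set.Icc (0 : ℝ) 1 := by simp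
  obtain ⟨L, ⟨hL0, hL⟩, -⟩ := Complex.isCoveringMapOn_exp.existsUnique_continuousMap_lifts F
    (a₀ := ((0 : ℝ), (1 : ℝ))) (e₀ := Complex.log (F (0, 1))) (Complex.exp_log (hF0 _))
    (fun v => hF0 v)
  have hexp : ∀ v, Complex.exp (L v) = F v := fun v => congrFun hL v
  obtain ⟨A, hA⟩ : ∃ A : ℝ × ℝ → ℝ, A = fun v => (L v).im := ⟨_, rfl⟩
  have hAc : Continuous A := by rw [hA]; fun_prop
  have hcos : ∀ v, f v = Real.exp (L v).re * Real.cos (A v) := by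
    intro v; rw [← hFre, ← hexp, Complex.exp_re, hA]
  have hsin : ∀ v, g v = Real.exp (L v).re * Real.sin (A v) := by
    intro v; rw [← hFim, ← hexp, Complex.exp_im, hA]
  have pi_p := Real.pi_pos
  have cneg : ∀ v, f v < 0 → Real.cos (A v) < 0 := by
    intro v h; rw [hcos] at h; by_contra h'; push Not at h'
    have := mul_nonneg (Real.exp_pos (L v).re).le h'; linarith
  have cpos : ∀ v, 0 < f v → 0 < Real.cos (A v) := by
    intro v h; rw [hcos] at h; exact (mul_pos_iff_of_pos_left (Real.exp_pos _)).1 h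
  have sneg : ∀ v, g v < 0 → Real.sin (A v) < 0 := by
    intro v h; rw [hsin] at h; by_contra h'; push Not at h'
    have := mul_nonneg (Real.exp_pos (L v).re).le h'; linarith
  have spos : ∀ v, 0 < g v → 0 < Real.sin (A v) := by
    intro v h; rw [hsin] at h; exact (mul_pos_iff_of_pos_left (Real.exp_pos _)).1 h
  have uI : Set.uIcc (0 : ℝ) 1 = Set.Icc 0 1 := Set.uIcc_of_le zero_le_one
  have uI' : Set.uIcc (1 : ℝ) 0 = Set.Icc 0 1 := by rw [Set.uIcc_comm, uI]
  -- top left corner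
  have a0 : A (0, 1) = Complex.arg (F (0, 1)) := by rw [hA]; simp only; rw [hL0, Complex.log_im]
  have a1 : 0 < A (0, 1) := by
    have h1 : 0 ≤ A (0, 1) := by rw [a0, Complex.arg_nonneg_iff, hFim]; exact (ht 0 m0).le
    rcases h1.eq_or_lt with h | h
    · have := cneg _ (hl 1 m1); rw [← h] at this; simp at this; linarith
    · exact h
  have a2 : A (0, 1) < Real.pi := by
    have h1 : A (0, 1) ≤ Real.pi := by rw [a0]; exact Complex.arg_le_pi _
    rcases h1.eq_or_lt with h | h
    · have := spos _ (ht 0 m0); rw [h] at this; simp at this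
    · exact h
  have a3 : Real.pi / 2 < A (0, 1) := by
    by_contra h; push Not at h
    have := Real.cos_nonneg_of_neg_pi_div_two_le_of_le (by linarith) h
    linarith [cneg _ (hl 1 m1)]
  -- top edge
  have b1 : 0 < A (1, 1) := by
    refine stay_gt (fun x => A (x, 1)) (by fun_prop) 0 1 0 (fun x hx h => ?_) a1
    rw [uI] at hx
    have := spos _ (ht x hx); rw [h] at this; simp at this
  have b2 : A (1, 1) < Real.pi := by
    refine stay_lt (fun x => A (x, 1)) (by fun_prop) 0 1 _ (fun x hx h => ?_) a2
    rw [uI] at hx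
    have := spos _ (ht x hx); rw [h] at this; simp at this
  have b3 : A (1, 1) < Real.pi / 2 := by
    by_contra h; push Not at h
    have := Real.cos_nonpos_of_pi_div_two_le_of_le h (by linarith)
    linarith [cpos _ (hr 1 m1)]
  -- right edge
  have c1 : A (1, 0) < Real.pi / 2 := by
    refine stay_lt (fun y => A (1, y)) (by fun_prop) 1 0 _ (fun y hy h => ?_) b3
    rw [uI'] at hy
    have := cpos _ (hr y hy); rw [h] at this; simp at this
  have c2 : -(Real.pi / 2) < A (1, 0) := by
    refine stay_gt (fun y => A (1, y)) (by fun_prop) 1 0 _ (fun y hy h => ?_)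
      (by linarith)
    rw [uI'] at hy
    have := cpos _ (hr y hy); rw [h, Real.cos_neg] at this; simp at this
  have c3 : A (1, 0) < 0 := by
    by_contra h; push Not at h
    have := Real.sin_nonneg_of_nonneg_of_le_pi h (by linarith)
    linarith [sneg _ (hb 1 m1)]
  -- bottom edge
  have d1 : A (0, 0) < 0 := by
    refine stay_lt (fun x => A (x, 0)) (by fun_prop) 1 0 _ (fun x hx h => ?_) c3
    rw [uI'] at hx
    have := sneg _ (hb x hx); rw [h] at this; simp at this
  -- left edge
  have e1 : Real.pi / 2 < A (0, 0) := by
    refine stay_gt (fun y => A (0, y)) (by fun_prop) 1 0 _ (fun y hy h => ?_) a3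
    rw [uI'] at hy
    have := cneg _ (hl y hy); rw [h] at this; simp at this
  linarith

theorem poincare_miranda (f g : ℝ → ℝ → ℝ)
    (hf : ContinuousOn (fun v : ℝ × ℝ => f v.1 v.2) (Set.Icc 0 1 ×ˢ Set.Icc 0 1))
    (hg : ContinuousOn (fun v : ℝ × ℝ => g v.1 v.2) (Set.Icc 0 1 ×ˢ Set.Icc 0 1))
    (hl : ∀ y ∈ Set.Icc (0 : ℝ) 1, f 0 y < 0) (hr : ∀ y ∈ Set.Icc (0 : ℝ) 1, 0 < f 1 y)
    (hb : ∀ x ∈ Set.Icc (0 : ℝ) 1, g x 0 < 0) (ht : ∀ x ∈ Set.Icc (0 : ℝ) 1, 0 < g x 1) :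
    ∃ x ∈ Set.Icc (0 : ℝ) 1, ∃ y ∈ Set.Icc (0 : ℝ) 1, f x y = 0 ∧ g x y = 0 := by
  let P : ℝ → ℝ := fun x => max 0 (min 1 x)
  have hPc : Continuous P := by fun_prop
  have hPm : ∀ x, P x ∈ Set.Icc (0 : ℝ) 1 := fun x =>
    ⟨le_max_left _ _, max_le zero_le_one (min_le_left _ _)⟩
  have hP : ∀ x ∈ Set.Icc (0 : ℝ) 1, P x = x := fun x hx => by simp [P, hx.1, hx.2]
  have m0 : (0 : ℝ) ∈ Set.Icc (0 : ℝ) 1 := by simp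
  have m1 : (1 : ℝ) ∈ Set.Icc (0 : ℝ) 1 := by simp
  obtain ⟨v, h1, h2⟩ := poincare_miranda_aux (fun v => f (P v.1) (P v.2))
    (fun v => g (P v.1) (P v.2))
    (hf.comp_continuous (f := fun v : ℝ × ℝ => (P v.1, P v.2)) (by fun_prop)
      (fun v => ⟨hPm _, hPm _⟩))
    (hg.comp_continuous (f := fun v : ℝ × ℝ => (P v.1, P v.2)) (by fun_prop)
      (fun v => ⟨hPm _, hPm _⟩))
    (fun y hy => by simp only [hP 0 m0, hP y hy]; exact hl y hy)
    (fun y hy => by simp only [hP 1 m1, hP y hy]; exact hr y hy)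
    (fun y hy => by simp only [hP 0 m0, hP y hy]; exact hb y hy)
    (fun y hy => by simp only [hP 1 m1, hP y hy]; exact ht y hy)
  exact ⟨P v.1, hPm _, P v.2, hPm _, h1, h2⟩

noncomputable def vN (τ l : ℝ) : ℝ :=
  (1 + τ) ^ 2 + τ * (τ ^ 2 + τ - 1) * l - (1 + τ) * τ ^ 2 * l ^ 2
noncomputable def vD₁ (τ l : ℝ) : ℝ := 2 + τ - τ * l
noncomputable def vD₂ (τ l : ℝ) : ℝ := 1 + τ + (2 + τ) * τ * l
noncomputable def vC (τ l : ℝ) : ℝ :=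
  -(2 + τ) ^ 2 * τ ^ 2 * l ^ 3 + (2 + τ) ^ 2 * (2 * τ - 1) * τ * l ^ 2 -
    (1 + τ) * (τ ^ 3 + τ ^ 2 - 5 * τ - 4) * l - (2 + τ) * (1 + τ) ^ 2
noncomputable def vea (τ l : ℝ) : ℝ := (1 + τ) ^ 2 + (1 + τ) * τ ^ 2 * l - τ ^ 3 * l ^ 2
noncomputable def veb (τ l : ℝ) : ℝ := 1 + τ * l * (1 - l)
noncomputable def vCc (τ l : ℝ) : ℝ := (2 + τ) * √(vea τ l) * (1 - l) / (2 * l)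
noncomputable def vsb (τ l : ℝ) : ℝ := τ / 2 * √(vD₂ τ l * veb τ l / vN τ l)
noncomputable def vSb (τ l : ℝ) : ℝ :=
  (2 + τ) * √(veb τ l) * (1 + τ + τ ^ 2 * l) / (2 * √τ * l)
noncomputable def Fq (q τ l : ℝ) : ℝ :=
  Real.pi + Real.arccos (vCc τ l) - q * Real.arcsin √(vC τ l / (4 * l * vN τ l))
noncomputable def Fp (p τ l : ℝ) : ℝ := Real.arsinh (vSb τ l) - p * Real.arsinh (vsb τ l)

/-- The region of parameters in which all auxiliary quantities are positive. -/
def Reg : Set (ℝ × ℝ) := {v | 0 < v.1 ∧ v.1 ≤ 61 / 100 ∧ 1 / 2 ≤ v.2 ∧ v.2 ≤ 7 / 5}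

theorem vN_pos (τ l : ℝ) (h : (τ, l) ∈ Reg) : 0 < vN τ l := by
  obtain ⟨h1, h2, h3, h4⟩ := h
  simp only at h1 h2 h3 h4
  unfold vN
  have a1 : τ * l ≤ τ * (7 / 5) := by gcongr
  have a2 : (τ * l) * (τ * l) ≤ (τ * (7 / 5)) * (τ * (7 / 5)) := by gcongr
  have a3 : (1 + τ) * ((τ * l) * (τ * l)) ≤ (1 + τ) * ((τ * (7 / 5)) * (τ * (7 / 5))) := by gcongr
  have a4 : 0 ≤ τ ^ 2 * (τ * l) := by positivity
  have a5 : 0 ≤ τ * (τ * l) := by positivity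
  nlinarith [mul_nonneg h1.le (sub_nonneg.2 h2), mul_nonneg (mul_nonneg h1.le h1.le) (sub_nonneg.2 h2)]

theorem vD₁_pos (τ l : ℝ) (h : (τ, l) ∈ Reg) : 0 < vD₁ τ l := by
  obtain ⟨h1, h2, h3, h4⟩ := h
  simp only at h1 h2 h3 h4
  unfold vD₁
  nlinarith

theorem vD₂_pos (τ l : ℝ) (h : (τ, l) ∈ Reg) : 0 < vD₂ τ l := by
  obtain ⟨h1, h2, h3, h4⟩ := h
  simp only at h1 h2 h3 h4
  unfold vD₂
  have : 0 < l := by linarith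
  positivity

theorem vea_pos (τ l : ℝ) (h : (τ, l) ∈ Reg) : 0 < vea τ l := by
  obtain ⟨h1, h2, h3, h4⟩ := h
  simp only at h1 h2 h3 h4
  unfold vea
  have hl : 0 < l := by linarith
  have a2 : (τ * l) * (τ * l) ≤ (61 / 100 * (7 / 5)) * (61 / 100 * (7 / 5)) := by gcongr
  have a3 : τ * ((τ * l) * (τ * l)) ≤ τ * ((61 / 100 * (7 / 5)) * (61 / 100 * (7 / 5))) := by gcongr
  have a4 : 0 ≤ (1 + τ) * τ ^ 2 * l := by positivity
  nlinarith

theorem veb_pos (τ l : ℝ) (h : (τ, l) ∈ Reg) : 0 < veb τ l := by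
  obtain ⟨h1, h2, h3, h4⟩ := h
  simp only at h1 h2 h3 h4
  unfold veb
  have hl : 0 < l := by linarith
  have : τ * l ≤ 61 / 100 * (7 / 5) := by gcongr
  have : 0 < τ * l := by positivity
  nlinarith

theorem reg_z4 (τ l : ℝ) (h : (τ, l) ∈ Reg) : 4 * τ * l ≤ vD₁ τ l * vD₂ τ l := by
  obtain ⟨h1, h2, h3, h4⟩ := h
  simp only at h1 h2 h3 h4
  unfold vD₁ vD₂
  have hl : 0 < l := by linarith
  have a1 : 0 < τ * l := by positivity
  have a2 : 2 - τ * (2 / 5) ≤ 2 + τ - τ * l := by nlinarith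
  have a3 : 17 / 10 ≤ 2 + τ - τ * l := by nlinarith
  have a4 : 1 + τ + 2 * (τ * l) ≤ 1 + τ + (2 + τ) * τ * l := by nlinarith
  have a5 : 17 / 10 * (1 + τ + 2 * (τ * l)) ≤ (2 + τ - τ * l) * (1 + τ + (2 + τ) * τ * l) := by
    gcongr
  nlinarith

theorem q_id1 (τ l : ℝ) : vD₁ τ l * vea τ l + vC τ l = 4 * l * vN τ l := by
  unfold vD₁ vea vC vN; ring

theorem q_id2 (τ l : ℝ) :
    vD₁ τ l * vC τ l + (2 + τ) ^ 2 * vea τ l * (1 - l) ^ 2 = 4 * l ^ 2 := by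
  unfold vD₁ vea vC; ring

theorem infinite_of_zero (m n : ℕ) (τ l : ℝ) (h : (τ, l) ∈ Reg)
    (hq : Fq (2 * m + 1) τ l = 0) (hp : Fp (2 * n + 1) τ l = 0) :
    Infinite (PresentedGroup (pretzelRels (2 * n + 1) (2 * m + 1)
      (2 * ((2 * n + 1) + (2 * m + 1)) - 1))) := by
  have hN := vN_pos τ l h
  have hD₁ := vD₁_pos τ l h
  have hD₂ := vD₂_pos τ l h
  have hea := vea_pos τ l h
  have heb := veb_pos τ l h
  have hτ : 0 < τ := h.1
  have hl : 0 < l := lt_of_lt_of_le (by norm_num) h.2.2.1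
  have pi_p := Real.pi_pos
  unfold Fq at hq
  unfold Fp at hp
  have hC : 0 < vC τ l := by
    by_contra hC
    push Not at hC
    rw [Real.sqrt_eq_zero_of_nonpos (div_nonpos_of_nonpos_of_nonneg hC (by positivity)),
      Real.arcsin_zero] at hq
    have := Real.arccos_nonneg (vCc τ l)
    linarith
  have i1 := q_id1 τ l
  have i2 := q_id2 τ l
  have hx1 : vC τ l / (4 * l * vN τ l) ≤ 1 := by
    rw [div_le_one (by positivity), ← i1]
    have : 0 < vD₁ τ l * vea τ l := by positivity
    linarith
  have hx0 : 0 ≤ vC τ l / (4 * l * vN τ l) := by positivity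
  obtain ⟨θ, hθ⟩ : ∃ θ, θ = Real.arcsin √(vC τ l / (4 * l * vN τ l)) := ⟨_, rfl⟩
  have hs : Real.sin θ = √(vC τ l / (4 * l * vN τ l)) := by
    rw [hθ, Real.sin_arcsin (by linarith [Real.sqrt_nonneg (vC τ l / (4 * l * vN τ l))])
      (Real.sqrt_le_one.2 hx1)]
  have hc : Real.cos θ = √(vD₁ τ l * vea τ l / (4 * l * vN τ l)) := by
    rw [hθ, Real.cos_arcsin, Real.sq_sqrt hx0]
    congr 1
    rw [eq_div_iff (by positivity), sub_mul, div_mul_cancel₀ _ (by positivity)]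
    linarith
  have hCc2 : 1 - vCc τ l ^ 2 = vD₁ τ l * vC τ l / (2 * l) ^ 2 := by
    unfold vCc
    rw [div_pow, mul_pow, mul_pow, Real.sq_sqrt hea.le]
    field_simp
    linear_combination -i2
  have hCcle : vCc τ l ^ 2 ≤ 1 := by
    have : 0 ≤ vD₁ τ l * vC τ l / (2 * l) ^ 2 := by positivity
    linarith
  have hCc := abs_le.1 ((sq_le_one_iff_abs_le_one _).1 hCcle)
  have hqθ : (2 * m + 1) * θ = Real.arccos (vCc τ l) + Real.pi := by rw [hθ]; linarith
  refine core m n τ l (2 + τ) (vN τ l) (vD₁ τ l) (vD₂ τ l) (vC τ l) (vea τ l) (veb τ l) θ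
    (Real.arsinh (vsb τ l)) hτ hl rfl ?_ ?_ ?_ ?_ ?_ ?_ hN hD₁ hD₂ hC hea heb
    (reg_z4 τ l h) hs hc ?_ ?_ ?_ ?_
  · unfold vN; ring
  · unfold vD₁; ring
  · unfold vD₂; ring
  · unfold vC; ring
  · unfold vea; ring
  · unfold veb; ring
  · rw [hqθ, Real.sin_add_pi, Real.sin_arccos, hCc2, Real.sqrt_div (by positivity),
      Real.sqrt_sq (by positivity)]
  · rw [hqθ, Real.cos_add_pi, Real.cos_arccos hCc.1 hCc.2]
    unfold vCc; rfl
  · rw [Real.sinh_arsinh]; unfold vsb; rfl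
  · rw [show (2 * (n : ℝ) + 1) * Real.arsinh (vsb τ l) = Real.arsinh (vSb τ l) by linarith,
      Real.sinh_arsinh]
    unfold vSb
    ring

theorem Fq_cont (q : ℝ) : ContinuousOn (fun v : ℝ × ℝ => Fq q v.1 v.2) Reg := by
  have cN : Continuous (fun v : ℝ × ℝ => vN v.1 v.2) := by unfold vN; fun_prop
  have cC : Continuous (fun v : ℝ × ℝ => vC v.1 v.2) := by unfold vC; fun_prop
  have hl : ∀ v ∈ Reg, v.2 ≠ 0 := fun v h => by have := h.2.2.1; intro h0; rw [h0] at this; norm_num at this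
  have hN : ∀ v ∈ Reg, vN v.1 v.2 ≠ 0 := fun v h => (vN_pos v.1 v.2 h).ne'
  have cCc : ContinuousOn (fun v : ℝ × ℝ => vCc v.1 v.2) Reg := by
    have c1 : Continuous (fun v : ℝ × ℝ => vea v.1 v.2) := by unfold vea; fun_prop
    unfold vCc
    apply ContinuousOn.div
    · exact Continuous.continuousOn (by fun_prop)
    · exact Continuous.continuousOn (by fun_prop)
    · intro v hv; exact mul_ne_zero two_ne_zero (hl v hv)
  have cs : ContinuousOn (fun v : ℝ × ℝ => vC v.1 v.2 / (4 * v.2 * vN v.1 v.2)) Reg := by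
    apply ContinuousOn.div
    · exact cC.continuousOn
    · exact Continuous.continuousOn (by fun_prop)
    · intro v hv; exact mul_ne_zero (mul_ne_zero (by norm_num) (hl v hv)) (hN v hv)
  unfold Fq
  exact (continuousOn_const.add (Real.continuous_arccos.comp_continuousOn cCc)).sub
    (continuousOn_const.mul (Real.continuous_arcsin.comp_continuousOn
      (Real.continuous_sqrt.comp_continuousOn cs)))

theorem Fp_cont (p : ℝ) : ContinuousOn (fun v : ℝ × ℝ => Fp p v.1 v.2) Reg := by
  have cN : Continuous (fun v : ℝ × ℝ => vN v.1 v.2) := by unfold vN; fun_prop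
  have cD : Continuous (fun v : ℝ × ℝ => vD₂ v.1 v.2) := by unfold vD₂; fun_prop
  have ceb : Continuous (fun v : ℝ × ℝ => veb v.1 v.2) := by unfold veb; fun_prop
  have hl : ∀ v ∈ Reg, v.2 ≠ 0 := fun v h => by have := h.2.2.1; intro h0; rw [h0] at this; norm_num at this
  have hN : ∀ v ∈ Reg, vN v.1 v.2 ≠ 0 := fun v h => (vN_pos v.1 v.2 h).ne'
  have hτ : ∀ v ∈ Reg, √v.1 ≠ 0 := fun v h => (Real.sqrt_pos.2 h.1).ne'
  have c1 : ContinuousOn (fun v : ℝ × ℝ => vSb v.1 v.2) Reg := by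
    unfold vSb
    apply ContinuousOn.div
    · exact Continuous.continuousOn (by fun_prop)
    · exact Continuous.continuousOn (by fun_prop)
    · intro v hv; exact mul_ne_zero (mul_ne_zero two_ne_zero (hτ v hv)) (hl v hv)
  have c2 : ContinuousOn (fun v : ℝ × ℝ => vsb v.1 v.2) Reg := by
    unfold vsb
    apply ContinuousOn.mul
    · exact Continuous.continuousOn (by fun_prop)
    · exact Real.continuous_sqrt.comp_continuousOn
        (ContinuousOn.div (cD.mul ceb).continuousOn cN.continuousOn hN)
  unfold Fp
  exact (Real.continuous_arsinh.comp_continuousOn c1).sub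
    (continuousOn_const.mul (Real.continuous_arsinh.comp_continuousOn c2))

theorem infinite_of_signs (m n : ℕ) (T L : ℝ → ℝ → ℝ)
    (hT : Continuous (fun v : ℝ × ℝ => T v.1 v.2)) (hL : Continuous (fun v : ℝ × ℝ => L v.1 v.2))
    (hR : ∀ x ∈ Set.Icc (0 : ℝ) 1, ∀ y ∈ Set.Icc (0 : ℝ) 1, (T x y, L x y) ∈ Reg)
    (h1 : ∀ y ∈ Set.Icc (0 : ℝ) 1, 0 < Fp (2 * n + 1) (T 0 y) (L 0 y))
    (h2 : ∀ y ∈ Set.Icc (0 : ℝ) 1, Fp (2 * n + 1) (T 1 y) (L 1 y) < 0)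
    (h3 : ∀ x ∈ Set.Icc (0 : ℝ) 1, 0 < Fq (2 * m + 1) (T x 0) (L x 0))
    (h4 : ∀ x ∈ Set.Icc (0 : ℝ) 1, Fq (2 * m + 1) (T x 1) (L x 1) < 0) :
    Infinite (PresentedGroup (pretzelRels (2 * n + 1) (2 * m + 1)
      (2 * ((2 * n + 1) + (2 * m + 1)) - 1))) := by
  have hΦ : ContinuousOn (fun v : ℝ × ℝ => (T v.1 v.2, L v.1 v.2)) (Set.Icc 0 1 ×ˢ Set.Icc 0 1) :=
    (hT.prodMk hL).continuousOn
  have hm : Set.MapsTo (fun v : ℝ × ℝ => (T v.1 v.2, L v.1 v.2)) (Set.Icc 0 1 ×ˢ Set.Icc 0 1) Reg :=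
    fun v hv => hR v.1 hv.1 v.2 hv.2
  obtain ⟨x, hx, y, hy, e1, e2⟩ := poincare_miranda
    (fun x y => -Fp (2 * n + 1) (T x y) (L x y)) (fun x y => -Fq (2 * m + 1) (T x y) (L x y))
    ((Fp_cont (2 * n + 1)).comp hΦ hm).neg ((Fq_cont (2 * m + 1)).comp hΦ hm).neg
    (fun y hy => neg_neg_of_pos (h1 y hy)) (fun y hy => neg_pos.2 (h2 y hy))
    (fun y hy => neg_neg_of_pos (h3 y hy)) (fun y hy => neg_pos.2 (h4 y hy))
  exact infinite_of_zero m n _ _ (hR x hx y hy) (neg_eq_zero.1 e2) (neg_eq_zero.1 e1)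

theorem sinh_seven (x : ℝ) : Real.sinh (7 * x) = Real.sinh x *
    (7 + 56 * Real.sinh x ^ 2 + 112 * (Real.sinh x ^ 2) ^ 2 + 64 * (Real.sinh x ^ 2) ^ 3) := by
  have e1 : Real.sinh (7 * x) = 2 * Real.sinh (3 * x) * Real.cosh (3 * x) * Real.cosh x +
      (Real.cosh (3 * x) ^ 2 + Real.sinh (3 * x) ^ 2) * Real.sinh x := by
    rw [show 7 * x = 2 * (3 * x) + x by ring, Real.sinh_add, Real.sinh_two_mul, Real.cosh_two_mul]
  rw [e1, Real.sinh_three_mul, Real.cosh_three_mul]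
  have h := Real.cosh_sq x
  obtain ⟨s, hs⟩ : ∃ s, s = Real.sinh x := ⟨_, rfl⟩
  obtain ⟨c, hc⟩ : ∃ c, c = Real.cosh x := ⟨_, rfl⟩
  rw [← hs, ← hc] at h ⊢
  have h4 : c ^ 4 = (s ^ 2 + 1) ^ 2 := by rw [← h]; ring
  have h6 : c ^ 6 = (s ^ 2 + 1) ^ 3 := by rw [← h]; ring
  ring_nf
  ring_nf at h4 h6
  rw [h, h4, h6]
  ring

theorem vsb_nonneg (τ l : ℝ) (h : (τ, l) ∈ Reg) : 0 ≤ vsb τ l := by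
  unfold vsb
  have : 0 < τ := h.1
  positivity

theorem vsb_sq (τ l : ℝ) (h : (τ, l) ∈ Reg) :
    vsb τ l ^ 2 * (4 * vN τ l) = τ ^ 2 * vD₂ τ l * veb τ l := by
  have hN := vN_pos τ l h
  have hD₂ := vD₂_pos τ l h
  have heb := veb_pos τ l h
  unfold vsb
  rw [mul_pow, Real.sq_sqrt (by positivity)]
  field_simp
  ring

theorem vSb_nonneg (τ l : ℝ) (h : (τ, l) ∈ Reg) : 0 ≤ vSb τ l := by
  unfold vSb
  have : 0 < τ := h.1
  have hl : 0 < l := lt_of_lt_of_le (by norm_num) h.2.2.1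
  positivity

theorem vSb_sq (τ l : ℝ) (h : (τ, l) ∈ Reg) :
    vSb τ l ^ 2 * (4 * τ * l ^ 2) = (2 + τ) ^ 2 * veb τ l * (1 + τ + τ ^ 2 * l) ^ 2 := by
  have heb := veb_pos τ l h
  have hτ : 0 < τ := h.1
  have hl : 0 < l := lt_of_lt_of_le (by norm_num) h.2.2.1
  unfold vSb
  rw [div_pow, mul_pow, mul_pow, mul_pow, mul_pow, Real.sq_sqrt heb.le, Real.sq_sqrt hτ.le]
  field_simp
  norm_num

theorem Fp_neg (n : ℕ) (hn : 3 ≤ n) (τ l w : ℝ) (h : (τ, l) ∈ Reg) (hw : 0 ≤ w)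
    (h1 : w * (4 * vN τ l) ≤ τ ^ 2 * vD₂ τ l * veb τ l)
    (h2 : (2 + τ) ^ 2 * (1 + τ + τ ^ 2 * l) ^ 2 * vN τ l <
      τ ^ 3 * l ^ 2 * vD₂ τ l * (7 + 56 * w + 112 * w ^ 2 + 64 * w ^ 3) ^ 2) :
    Fp (2 * n + 1) τ l < 0 := by
  have hN := vN_pos τ l h
  have heb := veb_pos τ l h
  have hτ : 0 < τ := h.1
  have hl : 0 < l := lt_of_lt_of_le (by norm_num) h.2.2.1
  have s0 := vsb_nonneg τ l h
  have s2 := vsb_sq τ l h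
  have S2 := vSb_sq τ l h
  have S0 := vSb_nonneg τ l h
  unfold Fp
  obtain ⟨s, hs⟩ : ∃ s, s = vsb τ l := ⟨_, rfl⟩
  obtain ⟨S, hS⟩ : ∃ S, S = vSb τ l := ⟨_, rfl⟩
  rw [← hs] at s0 s2 ⊢
  rw [← hS] at S2 S0 ⊢
  have hws : w ≤ s ^ 2 := by
    rw [← s2] at h1
    exact le_of_mul_le_mul_right h1 (by positivity)
  have hP : 7 + 56 * w + 112 * w ^ 2 + 64 * w ^ 3 ≤
      7 + 56 * s ^ 2 + 112 * (s ^ 2) ^ 2 + 64 * (s ^ 2) ^ 3 := by gcongr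
  have hSs : S ^ 2 < (s * (7 + 56 * w + 112 * w ^ 2 + 64 * w ^ 3)) ^ 2 := by
    have hk : 0 < 16 * τ * l ^ 2 * vN τ l := by positivity
    apply lt_of_mul_lt_mul_right _ hk.le
    calc S ^ 2 * (16 * τ * l ^ 2 * vN τ l) = (S ^ 2 * (4 * τ * l ^ 2)) * (4 * vN τ l) := by ring
      _ = 4 * veb τ l * ((2 + τ) ^ 2 * (1 + τ + τ ^ 2 * l) ^ 2 * vN τ l) := by rw [S2]; ring
      _ < 4 * veb τ l * (τ ^ 3 * l ^ 2 * vD₂ τ l * (7 + 56 * w + 112 * w ^ 2 + 64 * w ^ 3) ^ 2) := by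
        gcongr
      _ = (τ ^ 2 * vD₂ τ l * veb τ l) *
          (4 * τ * l ^ 2 * (7 + 56 * w + 112 * w ^ 2 + 64 * w ^ 3) ^ 2) := by ring
      _ = _ := by rw [← s2]; ring
  have hlt : S < Real.sinh (7 * Real.arsinh s) := by
    rw [sinh_seven, Real.sinh_arsinh]
    calc S < s * (7 + 56 * w + 112 * w ^ 2 + 64 * w ^ 3) :=
          lt_of_pow_lt_pow_left₀ 2 (by positivity) hSs
      _ ≤ _ := by gcongr
  have h3 : Real.arsinh S < 7 * Real.arsinh s := by
    rw [← Real.arsinh_lt_arsinh, Real.arsinh_sinh] at hlt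
    exact hlt
  have h4 : 0 ≤ Real.arsinh s := Real.arsinh_nonneg_iff.2 s0
  have h5 : (3 : ℝ) ≤ n := by exact_mod_cast hn
  nlinarith

theorem Fp_pos_seven (τ l w : ℝ) (h : (τ, l) ∈ Reg)
    (h1 : τ ^ 2 * vD₂ τ l * veb τ l ≤ w * (4 * vN τ l))
    (h2 : τ ^ 3 * l ^ 2 * vD₂ τ l * (7 + 56 * w + 112 * w ^ 2 + 64 * w ^ 3) ^ 2 <
      (2 + τ) ^ 2 * (1 + τ + τ ^ 2 * l) ^ 2 * vN τ l) :
    0 < Fp (2 * (3 : ℕ) + 1) τ l := by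
  have hN := vN_pos τ l h
  have heb := veb_pos τ l h
  have hτ : 0 < τ := h.1
  have hl : 0 < l := lt_of_lt_of_le (by norm_num) h.2.2.1
  have s0 := vsb_nonneg τ l h
  have s2 := vsb_sq τ l h
  have S2 := vSb_sq τ l h
  have S0 := vSb_nonneg τ l h
  unfold Fp
  obtain ⟨s, hs⟩ : ∃ s, s = vsb τ l := ⟨_, rfl⟩
  obtain ⟨S, hS⟩ : ∃ S, S = vSb τ l := ⟨_, rfl⟩
  rw [← hs] at s0 s2 ⊢
  rw [← hS] at S2 S0 ⊢
  have hws : s ^ 2 ≤ w := by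
    rw [← s2] at h1
    exact le_of_mul_le_mul_right h1 (by positivity)
  have hP : 7 + 56 * s ^ 2 + 112 * (s ^ 2) ^ 2 + 64 * (s ^ 2) ^ 3 ≤
      7 + 56 * w + 112 * w ^ 2 + 64 * w ^ 3 := by gcongr
  have hSs : (s * (7 + 56 * w + 112 * w ^ 2 + 64 * w ^ 3)) ^ 2 < S ^ 2 := by
    have hk : 0 < 16 * τ * l ^ 2 * vN τ l := by positivity
    apply lt_of_mul_lt_mul_right _ hk.le
    calc (s * (7 + 56 * w + 112 * w ^ 2 + 64 * w ^ 3)) ^ 2 * (16 * τ * l ^ 2 * vN τ l) =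
          (s ^ 2 * (4 * vN τ l)) *
          (4 * τ * l ^ 2 * (7 + 56 * w + 112 * w ^ 2 + 64 * w ^ 3) ^ 2) := by ring
      _ = 4 * veb τ l * (τ ^ 3 * l ^ 2 * vD₂ τ l * (7 + 56 * w + 112 * w ^ 2 + 64 * w ^ 3) ^ 2) := by
        rw [s2]; ring
      _ < 4 * veb τ l * ((2 + τ) ^ 2 * (1 + τ + τ ^ 2 * l) ^ 2 * vN τ l) := by gcongr
      _ = ((2 + τ) ^ 2 * veb τ l * (1 + τ + τ ^ 2 * l) ^ 2) * (4 * vN τ l) := by ring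
      _ = _ := by rw [← S2]; ring
  have hlt : Real.sinh (7 * Real.arsinh s) < S := by
    rw [sinh_seven, Real.sinh_arsinh]
    calc _ ≤ s * (7 + 56 * w + 112 * w ^ 2 + 64 * w ^ 3) := by gcongr
      _ < S := lt_of_pow_lt_pow_left₀ 2 S0 hSs
  rw [← Real.arsinh_lt_arsinh, Real.arsinh_sinh] at hlt
  push_cast
  linarith

theorem Fp_pos_small (p τ l : ℝ) (hp : 7 ≤ p) (hτ : τ = 1 / (10 * p)) (hl1 : 1 / 2 ≤ l)
    (hl2 : l ≤ 1) : 0 < Fp p τ l := by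
  have hτ0 : 0 < τ := by rw [hτ]; positivity
  have hτ1 : τ ≤ 1 / 70 := by
    rw [hτ]; apply one_div_le_one_div_of_le <;> linarith
  have hpτ : p * τ = 1 / 10 := by rw [hτ]; field_simp
  have h : (τ, l) ∈ Reg := ⟨hτ0, by simp only; linarith, hl1, by simp only; linarith⟩
  have hN := vN_pos τ l h
  have hl : 0 < l := by linarith
  have s0 := vsb_nonneg τ l h
  have s2 := vsb_sq τ l h
  have S2 := vSb_sq τ l h
  have S0 := vSb_nonneg τ l h
  have heb : 1 ≤ veb τ l := by unfold veb; nlinarith [mul_nonneg (mul_pos hτ0 hl).le (sub_nonneg.2 hl2)]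
  have heb2 : veb τ l ≤ 11 / 10 := by
    unfold veb
    have : τ * l * (1 - l) ≤ 1 / 70 * 1 * 1 := by gcongr <;> linarith
    linarith
  have hD2 : vD₂ τ l ≤ 12 / 10 := by
    unfold vD₂
    have : (2 + τ) * τ * l ≤ (2 + 1 / 70) * (1 / 70) * 1 := by gcongr
    linarith
  have hD0 := vD₂_pos τ l h
  have hN1 : 9 / 10 ≤ vN τ l := by
    unfold vN
    have a1 : (1 + τ) * τ ^ 2 * l ^ 2 ≤ (1 + 1 / 70) * (1 / 70) ^ 2 * 1 ^ 2 := by gcongr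
    have a2 : τ * l ≤ 1 / 70 * 1 := by gcongr
    have a3 : 0 ≤ τ * l := by positivity
    have a4 : 0 ≤ τ ^ 2 * (τ * l) := by positivity
    have a5 : 0 ≤ τ * (τ * l) := by positivity
    nlinarith
  have hs : vsb τ l ≤ τ := by
    have h1 : vsb τ l ^ 2 * (4 * vN τ l) ≤ τ ^ 2 * (4 * vN τ l) := by
      rw [s2, mul_assoc]
      have h2 : vD₂ τ l * veb τ l ≤ 12 / 10 * (11 / 10) := by gcongr
      exact mul_le_mul_of_nonneg_left (by linarith) (by positivity)
    exact le_of_sq_le_sq (le_of_mul_le_mul_right h1 (by positivity)) hτ0.le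
  have hS : 1 ≤ vSb τ l := by
    have h1 : 1 ^ 2 * (4 * τ * l ^ 2) ≤ vSb τ l ^ 2 * (4 * τ * l ^ 2) := by
      rw [S2]
      calc 1 ^ 2 * (4 * τ * l ^ 2) ≤ 1 ^ 2 * (4 * 1 * 1 ^ 2) := by gcongr; linarith
        _ = 2 ^ 2 * 1 * 1 ^ 2 := by norm_num
        _ ≤ (2 + τ) ^ 2 * veb τ l * (1 + τ + τ ^ 2 * l) ^ 2 := by
          gcongr
          · linarith
          · have : 0 ≤ τ ^ 2 * l := by positivity
            linarith
    exact le_of_sq_le_sq (le_of_mul_le_mul_right h1 (by positivity)) S0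
  have h1 : Real.arsinh (vsb τ l) ≤ τ := by
    have : Real.arsinh (vsb τ l) ≤ Real.arsinh (Real.sinh τ) :=
      Real.arsinh_le_arsinh.2 (hs.trans (Real.self_le_sinh_iff.2 hτ0.le))
    rwa [Real.arsinh_sinh] at this
  have h2 : 1 / 10 < Real.arsinh (vSb τ l) := by
    refine lt_of_lt_of_le ?_ (Real.arsinh_le_arsinh.2 hS)
    by_contra hcon
    push Not at hcon
    have h3 := Real.exp_le_exp.2 hcon
    rw [Real.exp_arsinh] at h3
    have h4 := Real.exp_bound_div_one_sub_of_interval (x := 1 / 10) (by norm_num) (by norm_num)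
    have h5 := Real.sqrt_nonneg (1 + 1 ^ 2 : ℝ)
    norm_num at h4 h3
    have h6 : (1 : ℝ) ≤ √2 := Real.one_le_sqrt.2 (by norm_num)
    linarith
  unfold Fp
  have h7 : p * Real.arsinh (vsb τ l) ≤ p * τ := by gcongr
  linarith

theorem Fq_pos_low (q τ l : ℝ) (h : (τ, l) ∈ Reg) (hC : vC τ l ≤ 0) : 0 < Fq q τ l := by
  have hN := vN_pos τ l h
  have hl : 0 < l := lt_of_lt_of_le (by norm_num) h.2.2.1
  unfold Fq
  rw [Real.sqrt_eq_zero_of_nonpos (div_nonpos_of_nonpos_of_nonneg hC (by positivity)),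
      Real.arcsin_zero]
  have := Real.arccos_nonneg (vCc τ l)
  have := Real.pi_pos
  linarith

theorem Fq_one (q τ : ℝ) (h : 0 < τ) :
    Fq q τ 1 = 3 * Real.pi / 2 - q * Real.arcsin √(1 / (2 * (1 + τ + τ ^ 2))) := by
  unfold Fq
  have h1 : vCc τ 1 = 0 := by unfold vCc; ring
  have h2 : vC τ 1 / (4 * 1 * vN τ 1) = 1 / (2 * (1 + τ + τ ^ 2)) := by
    have : vC τ 1 = 2 := by unfold vC; ring
    have h3 : vN τ 1 = 1 + τ + τ ^ 2 := by unfold vN; ring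
    rw [this, h3]; field_simp; norm_num
  rw [h1, h2, Real.arccos_zero]
  ring

theorem Fq_neg_one (q τ : ℝ) (hq : 9 ≤ q) (h : 0 < τ) (h2 : τ ≤ 61 / 100) : Fq q τ 1 < 0 := by
  rw [Fq_one q τ h]
  have h3 : Real.pi / 6 < Real.arcsin √(1 / (2 * (1 + τ + τ ^ 2))) := by
    rw [Real.lt_arcsin_iff_sin_lt' ⟨by linarith [Real.pi_pos], by linarith [Real.pi_pos]⟩]
    rw [Real.sin_pi_div_six]
    apply Real.lt_sqrt_of_sq_lt
    rw [lt_div_iff₀ (by positivity)]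
    nlinarith
  have := Real.pi_pos
  nlinarith

theorem general_case (m n : ℕ) (hn : 3 ≤ n) (hm : 4 ≤ m) :
    Infinite (PresentedGroup (pretzelRels (2 * n + 1) (2 * m + 1)
      (2 * ((2 * n + 1) + (2 * m + 1)) - 1))) := by
  have hn' : (3 : ℝ) ≤ n := by exact_mod_cast hn
  have hm' : (4 : ℝ) ≤ m := by exact_mod_cast hm
  obtain ⟨e, he⟩ : ∃ e : ℝ, e = 1 / (10 * (2 * n + 1)) := ⟨_, rfl⟩
  have he0 : 0 < e := by rw [he]; positivity
  have he1 : e ≤ 1 / 70 := by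
    rw [he]; apply one_div_le_one_div_of_le <;> linarith
  obtain ⟨T, hT⟩ : ∃ T : ℝ → ℝ, T = fun x => e + x * (3 / 5 - e) := ⟨_, rfl⟩
  have hTb : ∀ x ∈ Set.Icc (0 : ℝ) 1, 0 < T x ∧ T x ≤ 3 / 5 := by
    intro x hx
    rw [hT]
    constructor
    · have := mul_nonneg hx.1 (show 0 ≤ 3 / 5 - e by linarith)
      simp only; linarith
    · have := mul_nonneg (sub_nonneg.2 hx.2) (show 0 ≤ 3 / 5 - e by linarith)
      simp only; linarith
  have hT0 : T 0 = e := by rw [hT]; simp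
  have hT1 : T 1 = 3 / 5 := by rw [hT]; simp
  have hTc : Continuous T := by rw [hT]; fun_prop
  have hlo : ∀ x ∈ Set.Icc (0 : ℝ) 1, ∀ y ∈ Set.Icc (0 : ℝ) 1,
      1 / 2 + 3 / 10 * T x ≤ (1 / 2 + 3 / 10 * T x) + y * (1 / 2 - 3 / 10 * T x) ∧
      (1 / 2 + 3 / 10 * T x) + y * (1 / 2 - 3 / 10 * T x) ≤ 1 := by
    intro x hx y hy
    have := hTb x hx
    constructor
    · have := mul_nonneg hy.1 (show 0 ≤ 1 / 2 - 3 / 10 * T x by linarith)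
      linarith
    · have := mul_nonneg (sub_nonneg.2 hy.2) (show 0 ≤ 1 / 2 - 3 / 10 * T x by linarith)
      linarith
  have hR : ∀ x ∈ Set.Icc (0 : ℝ) 1, ∀ y ∈ Set.Icc (0 : ℝ) 1,
      (T x, (1 / 2 + 3 / 10 * T x) + y * (1 / 2 - 3 / 10 * T x)) ∈ Reg := by
    intro x hx y hy
    have h1 := hTb x hx
    have h2 := hlo x hx y hy
    exact ⟨h1.1, by simp only; linarith, by simp only; linarith, by simp only; linarith⟩
  have m0 : (0 : ℝ) ∈ Set.Icc (0 : ℝ) 1 := by simp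
  have m1 : (1 : ℝ) ∈ Set.Icc (0 : ℝ) 1 := by simp
  refine infinite_of_signs m n (fun x _ => T x)
    (fun x y => (1 / 2 + 3 / 10 * T x) + y * (1 / 2 - 3 / 10 * T x))
    (by fun_prop) (by fun_prop) hR ?_ ?_ ?_ ?_
  · intro y hy
    have := hlo 0 m0 y hy
    rw [hT0] at this
    simp only [hT0]
    exact Fp_pos_small _ _ _ (by linarith) he (by linarith) this.2
  · intro y hy
    have h1 := hlo 1 m1 y hy
    have h2 := hR 1 m1 y hy
    generalize (1 / 2 + 3 / 10 * T 1) + y * (1 / 2 - 3 / 10 * T 1) = l at *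
    rw [hT1] at h1 h2 ⊢
    have hl1 : 68 / 100 ≤ l := by linarith
    have hl2 := h1.2
    apply Fp_neg n hn (3 / 5) l (118 / 1000) h2 (by norm_num)
    · unfold vN vD₂ veb
      nlinarith [mul_nonneg (sub_nonneg.2 hl1) (sub_nonneg.2 hl2),
        mul_nonneg (mul_nonneg (sub_nonneg.2 hl1) (sub_nonneg.2 hl2)) (sub_nonneg.2 hl1)]
    · have hN : vN (3 / 5) l ≤ 22774 / 10000 := by unfold vN; nlinarith
      have hD : 266 / 100 ≤ vD₂ (3 / 5) l := by unfold vD₂; linarith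
      have hP : (1 + 3 / 5 + (3 / 5) ^ 2 * l) ≤ 2713 / 1000 * l := by linarith
      have hl0 : 0 < l := by linarith
      have hN0 := (vN_pos _ _ h2).le
      calc (2 + 3 / 5) ^ 2 * (1 + 3 / 5 + (3 / 5) ^ 2 * l) ^ 2 * vN (3 / 5) l
          ≤ (2 + 3 / 5) ^ 2 * (2713 / 1000 * l) ^ 2 * (22774 / 10000) := by gcongr
        _ < (3 / 5) ^ 3 * l ^ 2 * (266 / 100) * (7 + 56 * (118 / 1000) +
            112 * (118 / 1000) ^ 2 + 64 * (118 / 1000) ^ 3) ^ 2 := by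
          have : 0 < l ^ 2 := by positivity
          nlinarith
        _ ≤ _ := by gcongr
  · intro x hx
    refine Fq_pos_low _ _ _ (hR x hx 0 m0) ?_
    obtain ⟨h1, h2⟩ := hTb x hx
    generalize T x = τ at *
    rw [zero_mul, add_zero]
    unfold vC
    have h3 := sub_nonneg.2 h2
    have b1 := mul_nonneg h1.le h3
    have b2 := mul_nonneg h1.le b1
    have b3 := mul_nonneg h1.le b2
    have b4 := mul_nonneg h1.le b3
    have b6 : 0 ≤ τ ^ 6 := by positivity
    have b7 : 0 ≤ τ ^ 7 := by positivity
    have b8 : 0 ≤ τ ^ 2 := by positivity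
    linarith
  · intro x hx
    obtain ⟨h1, h2⟩ := hTb x hx
    rw [show (1 / 2 + 3 / 10 * T x) + 1 * (1 / 2 - 3 / 10 * T x) = 1 by ring]
    exact Fq_neg_one _ _ (by linarith) h1 (by linarith)

theorem Fq_pos_one_seven (τ : ℝ) (h1 : 3 / 10 ≤ τ) : 0 < Fq (2 * (3 : ℕ) + 1) τ 1 := by
  rw [Fq_one _ τ (by linarith)]
  have h2 : Real.arcsin √(1 / (2 * (1 + τ + τ ^ 2))) < 67 / 100 := by
    have hpi := Real.pi_gt_d2
    rw [Real.arcsin_lt_iff_lt_sin' ⟨by linarith, by linarith⟩]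
    have h3 := Real.sin_bound (x := 67 / 100) (by rw [abs_of_pos] <;> norm_num)
    rw [abs_le] at h3
    have h5 : |(67 / 100 : ℝ)| = 67 / 100 := abs_of_pos (by norm_num)
    rw [h5] at h3
    have h4 : √(1 / (2 * (1 + τ + τ ^ 2))) ≤ 6 / 10 := by
      apply Real.sqrt_le_iff.2 ⟨by norm_num, ?_⟩
      rw [div_le_iff₀ (by nlinarith)]
      nlinarith
    have := h3.1
    norm_num at this
    linarith
  have hpi := Real.pi_gt_d2
  push_cast
  linarith

theorem Fq_neg_top_seven (τ : ℝ) (h1 : 3 / 10 ≤ τ) (h2 : τ ≤ 34 / 100) :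
    Fq (2 * (3 : ℕ) + 1) τ (7 / 5) < 0 := by
  have hpi := Real.pi_gt_d2
  have hpi2 := Real.pi_lt_d2
  have hR : (τ, (7 / 5 : ℝ)) ∈ Reg :=
    ⟨by simp only; linarith, by simp only; linarith, by norm_num, by norm_num⟩
  have hN := vN_pos _ _ hR
  have hea := vea_pos _ _ hR
  have e1 : Real.arccos (vCc τ (7 / 5)) ≤ 2 * Real.pi / 3 := by
    have h3 : √(vea τ (7 / 5)) ≤ 14 / 10 := by
      apply Real.sqrt_le_iff.2 ⟨by norm_num, ?_⟩
      unfold vea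
      have a1 : (1 + τ) ^ 2 ≤ (1 + 34 / 100) ^ 2 := by gcongr
      have a2 : (1 + τ) * τ ^ 2 * (7 / 5) ≤ (1 + 34 / 100) * (34 / 100) ^ 2 * (7 / 5) := by gcongr
      have a3 : (3 / 10) ^ 3 * (7 / 5) ^ 2 ≤ τ ^ 3 * (7 / 5 : ℝ) ^ 2 := by gcongr
      linarith
    have h4 : -(1 / 2) ≤ vCc τ (7 / 5) := by
      unfold vCc
      have a1 : (2 + τ) * √(vea τ (7 / 5)) ≤ (2 + 34 / 100) * (14 / 10) := by gcongr
      rw [le_div_iff₀ (by norm_num)]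
      linarith
    have h5 := Real.arccos_le_arccos h4
    rw [Real.arccos_neg, ← Real.cos_pi_div_three, Real.arccos_cos (by linarith) (by linarith)] at h5
    linarith
  have e2 : 5 * Real.pi / 21 < Real.arcsin √(vC τ (7 / 5) / (4 * (7 / 5) * vN τ (7 / 5))) := by
    rw [Real.lt_arcsin_iff_sin_lt' ⟨by linarith, by linarith⟩]
    apply Real.lt_sqrt_of_sq_lt
    have h3 : Real.sin (5 * Real.pi / 21) ^ 2 = 1 / 2 - Real.sin (Real.pi / 42) / 2 := by
      rw [Real.sin_sq_eq_half_sub, ← Real.cos_pi_div_two_sub (Real.pi / 42)]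
      congr 3
      ring
    have h4 := Real.sin_gt_sub_cube (x := Real.pi / 42) (by positivity)
    have h5 : (Real.pi / 42) ^ 3 ≤ (3.15 / 42) ^ 3 := by gcongr
    rw [h3, lt_div_iff₀ (by positivity)]
    have h6 : (463 / 1000 : ℝ) * (4 * (7 / 5) * vN τ (7 / 5)) < vC τ (7 / 5) := by
      obtain ⟨y, hy⟩ : ∃ y, τ = 3 / 10 + y := ⟨τ - 3 / 10, by ring⟩
      subst hy
      have y0 : 0 ≤ y := by linarith
      have y1 : 0 ≤ 4 / 100 - y := by linarith
      unfold vC vN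
      have b1 := mul_nonneg y0 y1
      have b2 := mul_nonneg y0 b1
      have b3 := mul_nonneg y0 b2
      have b4 : 0 ≤ y ^ 3 := by positivity
      linarith
    refine lt_of_le_of_lt ?_ h6
    gcongr
    norm_num at h5 ⊢
    linarith
  unfold Fq
  push_cast
  linarith

theorem Fp_pos_left_seven (l : ℝ) (h1 : 1 ≤ l) (h2 : l ≤ 7 / 5) :
    0 < Fp (2 * (3 : ℕ) + 1) (3 / 10) l := by
  have hR : ((3 / 10 : ℝ), l) ∈ Reg :=
    ⟨by norm_num, by norm_num, by simp only; linarith, by simp only; linarith⟩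
  obtain ⟨y, hy⟩ : ∃ y, l = 1 + y := ⟨l - 1, by ring⟩
  subst hy
  have y0 : 0 ≤ y := by linarith
  have y1 : 0 ≤ 2 / 5 - y := by linarith
  have b1 := mul_nonneg y0 y1
  have b2 := mul_nonneg y0 b1
  have b3 := mul_nonneg y0 b2
  have b4 : 0 ≤ y ^ 3 := by positivity
  refine Fp_pos_seven _ _ (36 / 1000) hR ?_ ?_
  · unfold vN vD₂ veb
    linarith [sq_nonneg (y - 2 / 5)]
  · have hD := vD₂_pos _ _ hR
    calc (3 / 10) ^ 3 * (1 + y) ^ 2 * vD₂ (3 / 10) (1 + y) * (7 + 56 * (36 / 1000) +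
          112 * (36 / 1000) ^ 2 + 64 * (36 / 1000) ^ 3) ^ 2
        ≤ (3 / 10) ^ 3 * (1 + y) ^ 2 * vD₂ (3 / 10) (1 + y) * 84 := by
          gcongr
          norm_num
      _ < _ := by
        unfold vN vD₂
        linarith

theorem Fp_neg_right_seven (y : ℝ) (y0 : 0 ≤ y) (h2 : y ≤ 2 / 5) :
    Fp (2 * (3 : ℕ) + 1) (44 / 100 - y / 4) (1 + y) < 0 := by
  have hR : ((44 / 100 - y / 4 : ℝ), 1 + y) ∈ Reg :=
    ⟨by simp only; linarith, by simp only; linarith, by simp only; linarith, by simp only; linarith⟩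
  have y1 : 0 ≤ 2 / 5 - y := by linarith
  have b1 := mul_nonneg y0 y1
  have b2 := mul_nonneg y0 b1
  have b3 := mul_nonneg y0 b2
  have b4 := mul_nonneg y0 b3
  have b5 := mul_nonneg y0 b4
  have b6 := mul_nonneg y0 b5
  have b7 := mul_nonneg y0 b6
  have b9 := mul_nonneg (mul_nonneg y0 y0) b7
  have b10 := mul_nonneg y0 b9
  have b11 := mul_nonneg y0 b10
  have b12 := mul_nonneg y0 b11
  have p3 : 0 ≤ y ^ 3 := by positivity
  have p4 : 0 ≤ y ^ 4 := by positivity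
  have p5 : 0 ≤ y ^ 5 := by positivity
  have p6 : 0 ≤ y ^ 6 := by positivity
  have p7 : 0 ≤ y ^ 7 := by positivity
  have p8 : 0 ≤ y ^ 8 := by positivity
  have p9 : 0 ≤ y ^ 9 := by positivity
  have p10 : 0 ≤ y ^ 10 := by positivity
  have p12 : 0 ≤ y ^ 12 := by positivity
  obtain ⟨w, hw⟩ : ∃ w, w = 73 / 1000 - 69 / 1000 * y := ⟨_, rfl⟩
  have hw0 : 454 / 10000 ≤ w := by linarith
  refine Fp_neg 3 le_rfl _ _ w hR (by linarith) ?_ ?_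
  · rw [hw]
    unfold vN vD₂ veb
    linarith [mul_nonneg y0 (sq_nonneg (y - 35 / 100)), sq_nonneg y]
  · have hD := vD₂_pos _ _ hR
    have hτ : 0 < 44 / 100 - y / 4 := by linarith
    have hK : 130 - 88 * y ≤ (7 + 56 * w + 112 * w ^ 2 + 64 * w ^ 3) ^ 2 := by
      have hw0' : 0 ≤ w := by linarith
      have c1 : (7 + 56 * w + 112 * w ^ 2) ^ 2 ≤ (7 + 56 * w + 112 * w ^ 2 + 64 * w ^ 3) ^ 2 := by
        apply pow_le_pow_left₀ (by positivity)
        have : 0 ≤ 64 * w ^ 3 := by positivity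
        linarith
      refine le_trans ?_ c1
      have c2 : 0 ≤ w ^ 2 * (w - 454 / 10000) := mul_nonneg (by positivity) (by linarith)
      have c3 : 0 ≤ w ^ 4 := by positivity
      have c4 : y = (73 / 1000 - w) * (1000 / 69) := by linarith
      rw [c4]
      linarith [sq_nonneg (w - 466 / 10000)]
    calc (2 + (44 / 100 - y / 4)) ^ 2 * (1 + (44 / 100 - y / 4) +
          (44 / 100 - y / 4) ^ 2 * (1 + y)) ^ 2 * vN (44 / 100 - y / 4) (1 + y)
        < (44 / 100 - y / 4) ^ 3 * (1 + y) ^ 2 * vD₂ (44 / 100 - y / 4) (1 + y) *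
          (130 - 88 * y) := by
          unfold vN vD₂
          linarith
      _ ≤ _ := by gcongr

theorem seven_seven :
    Infinite (PresentedGroup (pretzelRels (2 * (3 : ℕ) + 1) (2 * (3 : ℕ) + 1)
      (2 * ((2 * (3 : ℕ) + 1) + (2 * (3 : ℕ) + 1)) - 1))) := by
  refine infinite_of_signs 3 3
    (fun x y => 3 / 10 + x * (14 / 100 - y / 10))
    (fun _ y => 1 + 2 / 5 * y) (by fun_prop) (by fun_prop) ?_ ?_ ?_ ?_ ?_
  · rintro x ⟨hx0, hx1⟩ y ⟨hy0, hy1⟩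
    have h1 : 0 ≤ x * (14 / 100 - y / 10) := mul_nonneg hx0 (by linarith)
    have h2 : x * (14 / 100 - y / 10) ≤ 1 * (14 / 100) := by
      gcongr
      · linarith
      · linarith
    exact ⟨by simp only; linarith, by simp only; linarith, by simp only; linarith,
      by simp only; linarith⟩
  · rintro y ⟨hy0, hy1⟩
    simp only [zero_mul, add_zero]
    exact Fp_pos_left_seven _ (by linarith) (by linarith)
  · rintro y ⟨hy0, hy1⟩
    have := Fp_neg_right_seven (2 / 5 * y) (by linarith) (by linarith)
    rwa [show 3 / 10 + 1 * (14 / 100 - y / 10) = 44 / 100 - 2 / 5 * y / 4 by ring]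
  · rintro x ⟨hx0, hx1⟩
    simp only [mul_zero, add_zero, zero_div, sub_zero]
    exact Fq_pos_one_seven _ (by linarith)
  · rintro x ⟨hx0, hx1⟩
    rw [show (1 + 2 / 5 * 1 : ℝ) = 7 / 5 by norm_num]
    exact Fq_neg_top_seven _ (by linarith) (by linarith)

/-- `2(p+q)-1` surgery on the `(-2,p,q)` pretzel knot (with `p,q` odd, `5 ≤ p ≤ q`,
`(p,q) ≠ (5,5)`) has infinite fundamental group. -/
theorem surgery_2pq_minus_one_infinite (p q : ℤ) (hp : Odd p) (hq : Odd q)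
    (hp5 : 5 ≤ p) (hpq : p ≤ q) (hne : ¬(p = 5 ∧ q = 5)) :
    Infinite (PresentedGroup (pretzelRels p q (2 * (p + q) - 1))) := by
  obtain ⟨k, rfl⟩ := hp
  obtain ⟨j, rfl⟩ := hq
  lift k to ℕ using by omega
  lift j to ℕ using by omega
  rcases (show k = 2 ∨ 3 ≤ k by omega) with rfl | hk
  · exact case_five j (by omega)
  · rcases (show (k = 3 ∧ j = 3) ∨ 4 ≤ j by omega) with ⟨rfl, rfl⟩ | hj
    · exact seven_seven
    · exact general_case j k hk hj
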